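/- arXiv:1707.06678 — 2 statements merged into one kernel-verified Lean document; each statement's English description precedes it below -/
import Mathlib

section
/- The equation (x+1)² + ... + (x+6)² = yⁿ has no integer solutions for any n ≥ 2. -/
lemma cast3 {q : ℕ} {Y : ℤ} (h : ¬ (q:ℤ) ∣ Y) : ((Y:ℤ) : ZMod q) ≠ 0 := by
  rwa [Ne, ZMod.intCast_zmod_eq_zero_iff_dvd]

set_option maxHeartbeats 2000000 in
lemma forms_excl (Y s v A B C : ℤ) (h3 : ¬ (3:ℤ) ∣ Y) (h5 : ¬ (5:ℤ) ∣ Y) (h7 : ¬ (7:ℤ) ∣ Y)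
    (hA : 0 < A) (hd : A * C - B^2 = 105) (hB1 : -A ≤ 2*B) (hB2 : 2*B ≤ A) (hAC : A ≤ C)
    (h : A*s^2+2*B*s*v+C*v^2 = 2*Y^2) : A = 2 := by
  have hA11 : A ≤ 11 := by nlinarith
  have k3 := cast3 (q := 3) h3
  have k5 := cast3 (q := 5) h5
  have k7 := cast3 (q := 7) h7
  have e3 := congrArg (Int.cast : ℤ → ZMod 3) h
  have e5 := congrArg (Int.cast : ℤ → ZMod 5) h
  have e7 := congrArg (Int.cast : ℤ → ZMod 7) h
  push_cast at e3 e5 e7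
  clear h h3 h5 h7
  by_contra hA2
  have hB3 : -5 ≤ B := by omega
  have hB4 : B ≤ 5 := by omega
  have key : (A = 1 ∧ B = 0 ∧ C = 105) ∨ (A = 3 ∧ B = 0 ∧ C = 35) ∨ (A = 5 ∧ B = 0 ∧ C = 21) ∨
      (A = 7 ∧ B = 0 ∧ C = 15) ∨ (A = 6 ∧ B = 3 ∧ C = 19) ∨ (A = 6 ∧ B = -3 ∧ C = 19) ∨
      (A = 10 ∧ B = 5 ∧ C = 13) ∨ (A = 10 ∧ B = -5 ∧ C = 13) ∨
      (A = 11 ∧ B = 4 ∧ C = 11) ∨ (A = 11 ∧ B = -4 ∧ C = 11) := by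
    clear e3 e5 e7 k3 k5 k7
    interval_cases A <;> interval_cases B <;> first | (exfalso; omega) | (norm_num; omega)
  generalize (s : ZMod 3) = s3 at *
  generalize (v : ZMod 3) = v3 at *
  generalize (Y : ZMod 3) = y3 at *
  generalize (s : ZMod 5) = s5 at *
  generalize (v : ZMod 5) = v5 at *
  generalize (Y : ZMod 5) = y5 at *
  generalize (s : ZMod 7) = s7 at *
  generalize (v : ZMod 7) = v7 at *
  generalize (Y : ZMod 7) = y7 at *
  rcases key with ⟨rfl, rfl, rfl⟩ | ⟨rfl, rfl, rfl⟩ | ⟨rfl, rfl, rfl⟩ | ⟨rfl, rfl, rfl⟩ |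
    ⟨rfl, rfl, rfl⟩ | ⟨rfl, rfl, rfl⟩ | ⟨rfl, rfl, rfl⟩ | ⟨rfl, rfl, rfl⟩ | ⟨rfl, rfl, rfl⟩ |
    ⟨rfl, rfl, rfl⟩
  · clear e5 e7; revert s3 v3 y3; decide
  · clear e5 e3; revert s7 v7 y7; decide
  · clear e3 e7; revert s5 v5 y5; decide
  · clear e5 e7; revert s3 v3 y3; decide
  · clear e5 e7; revert s3 v3 y3; decide
  · clear e5 e7; revert s3 v3 y3; decide
  · clear e5 e7; revert s3 v3 y3; decide
  · clear e5 e7; revert s3 v3 y3; decide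
  · clear e3 e7; revert s5 v5 y5; decide
  · clear e3 e7; revert s5 v5 y5; decide

lemma forms_red (Y : ℤ) (h3 : ¬ (3:ℤ) ∣ Y) (h5 : ¬ (5:ℤ) ∣ Y) (h7 : ¬ (7:ℤ) ∣ Y) :
    ∀ N : ℕ, ∀ A B C : ℤ, 0 < A → A ≤ N → A * C - B^2 = 105 →
    (∃ s v : ℤ, A*s^2+2*B*s*v+C*v^2 = 2*Y^2) → ∃ s v : ℤ, A*s^2+2*B*s*v+C*v^2 = 2 := by
  intro N
  induction N with
  | zero => intro A B C h1 h2; simp at h2; omega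
  | succ N ih =>
    intro A B C hA hN hd ⟨s, v, h⟩
    obtain ⟨q, hq1, hq2⟩ : ∃ q : ℤ, -A ≤ 2*(B - A*q) ∧ 2*(B-A*q) ≤ A := by
      refine ⟨(2*B+A)/(2*A), ?_⟩
      have e1 := Int.mul_ediv_add_emod (2*B+A) (2*A)
      have e2 := Int.emod_nonneg (2*B+A) (show 2*A ≠ 0 by omega)
      have e3 := Int.emod_lt_of_pos (2*B+A) (show 0 < 2*A by omega)
      constructor <;> nlinarith
    have hd' : A * (C - 2*B*q+A*q^2) - (B-A*q)^2 = 105 := by linear_combination hd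
    have h' : A*(s+q*v)^2+2*(B-A*q)*(s+q*v)*v+(C - 2*B*q+A*q^2)*v^2 = 2*Y^2 := by
      linear_combination h
    have hback : (∃ s v : ℤ, A*s^2+2*(B-A*q)*s*v+(C - 2*B*q+A*q^2)*v^2 = 2) → 
        ∃ s v : ℤ, A*s^2+2*B*s*v+C*v^2 = 2 := by
      rintro ⟨s, v, h⟩
      exact ⟨s - q*v, v, by linear_combination h⟩
    apply hback
    generalize B - A*q = B' at *
    generalize C - 2*B*q+A*q^2 = C' at *
    generalize s+q*v = s' at *
    by_cases hAC : A ≤ C'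
    · have := forms_excl Y s' v A B' C' h3 h5 h7 hA hd' hq1 hq2 hAC h'
      exact ⟨1, 0, by rw [this]; ring⟩
    · have hC : 0 < C' := by
        by_contra hc
        nlinarith [sq_nonneg B']
      obtain ⟨s1, v1, h1⟩ := ih C' B' A hC (by push_cast at hN; omega) (by linarith)
        ⟨v, s', by linarith⟩
      exact ⟨v1, s1, by linarith⟩

/-- 19-adic part. -/
lemma odd_part (a w : ℤ) (hw : 2*w = 3*a^2-35) (k : ℕ)
    (h : 3*a*((⟨w, a⟩ : ℤ√(-105))^(2*k+1)).im + ((⟨w, a⟩ : ℤ√(-105))^(2*k+1)).re = -1) : False := by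
  let f1 : ℤ√(-105) →+* ZMod 19 := Zsqrtd.lift ⟨3, by decide⟩
  let f2 : ℤ√(-105) →+* ZMod 19 := Zsqrtd.lift ⟨-3, by decide⟩
  have e : ((⟨3*a,1⟩ * (⟨w, a⟩ : ℤ√(-105))^(2*k+1) : ℤ√(-105))).im = -1 := by
    rw [Zsqrtd.im_mul]; linarith
  have t1 : f1 (⟨3*a,1⟩ * (⟨w, a⟩ : ℤ√(-105))^(2*k+1)) - f2 (⟨3*a,1⟩ * (⟨w, a⟩ : ℤ√(-105))^(2*k+1)) = -6 := by
    generalize (⟨3*a,1⟩ * (⟨w, a⟩ : ℤ√(-105))^(2*k+1) : ℤ√(-105)) = z at *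
    simp only [f1, f2, Zsqrtd.lift_apply_apply, e]
    push_cast; ring
  simp only [map_mul, map_pow] at t1
  simp only [f1, f2, Zsqrtd.lift_apply_apply] at t1
  have hw' := congrArg (Int.cast : ℤ → ZMod 19) hw
  push_cast at t1 hw'
  generalize (a : ZMod 19) = a at *
  generalize (w : ZMod 19) = w at *
  have hw2 : w = 10*(3*a^2-35) := by
    rw [← hw', ← mul_assoc, show (10*2 : ZMod 19) = 1 by decide, one_mul]
  subst hw2
  have per : ∀ x : ZMod 19, x^(2*k+1) = x^(2*(k%9)+1) := by
    intro x
    have h0 : ∀ x : ZMod 19, x^18*x = x := by decide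
    have : ∀ j m : ℕ, x^(2*(m+9*j)+1) = x^(2*m+1) := by
      intro j m
      induction j with
      | zero => simp
      | succ j ih =>
        rw [← ih, show 2*(m+9*(j+1))+1 = 2*(m+9*j) + 18 + 1 by ring, pow_succ, pow_add, mul_assoc, h0, ← pow_succ]
    conv_lhs => rw [← Nat.mod_add_div k 9]
    exact this _ _
  rw [per, per] at t1
  have hk : k % 9 < 9 := Nat.mod_lt _ (by norm_num)
  generalize k % 9 = m at *
  clear per hw' e h
  revert a
  interval_cases m <;> decide

lemma five_pow (z : ℤ√(-105)) (K : ℕ) (h1 : (5:ℤ)^(K+1) ∣ z.re - 1) (h2 : (5:ℤ)^K ∣ z.im)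
    (h3 : ¬ (5:ℤ)^(K+1) ∣ z.im) :
    (5:ℤ)^(K+2) ∣ (z^5).re - 1 ∧ (5:ℤ)^(K+1) ∣ (z^5).im ∧ ¬ (5:ℤ)^(K+2) ∣ (z^5).im := by
  obtain ⟨P, Q⟩ := z
  simp only at h1 h2 h3
  have hre : ((⟨P, Q⟩ : ℤ√(-105))^5).re = P^5 - 1050*P^3*Q^2 + 55125*P*Q^4 := by
    simp [pow_succ]; ring
  have him : ((⟨P, Q⟩ : ℤ√(-105))^5).im = 5*Q*(P^4-210*P^2*Q^2+2205*Q^4) := by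
    simp [pow_succ]; ring
  obtain ⟨p, hp⟩ := h1
  obtain ⟨q, rfl⟩ := h2
  have hP : P = 1 + 5^(K+1)*p := by linarith
  rw [hre, him]
  refine ⟨?_, ?_, ?_⟩
  · subst hP
    generalize hT : (5:ℤ)^K = T at *
    rw [show (5:ℤ)^(K+2) = 25*T by rw [← hT]; ring, show (5:ℤ)^(K+1) = 5*T by rw [← hT]; ring]
    refine ⟨p + 10*T*p^2 + 50*T^2*p^3+125*T^3*p^4+125*T^4*p^5 - 42*(1+5*T*p)^3*T*q^2 + 2205*(1+5*T*p)*T^3*q^4, ?_⟩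
    ring
  · exact ⟨q*(P^4-210*P^2*(5^K*q)^2+2205*(5^K*q)^4), by ring⟩
  · intro hd
    have h5 : (5:ℤ) ∣ q*(P^4-210*P^2*(5^K*q)^2+2205*(5^K*q)^4) := by
      have : (5:ℤ)^(K+1)*5 ∣ 5^(K+1)*(q*(P^4-210*P^2*(5^K*q)^2+2205*(5^K*q)^4)) := by
        rw [pow_succ, pow_succ] at hd
        rw [pow_succ]
        have e : (5:ℤ)^K*5*(q*(P^4-210*P^2*(5^K*q)^2+2205*(5^K*q)^4)) = 5*(5^K*q)*(P^4-210*P^2*(5^K*q)^2+2205*(5^K*q)^4) := by ring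
        rw [e]; exact hd
      exact (mul_dvd_mul_iff_left (by positivity)).1 this
    have hp5 : Prime (5:ℤ) := by norm_num
    rcases hp5.dvd_or_dvd h5 with h | h
    · apply h3
      rw [pow_succ]
      exact mul_dvd_mul_left _ h
    · have : (5:ℤ) ∣ P^4 := by
        have e : P^4 = (P^4-210*P^2*(5^K*q)^2+2205*(5^K*q)^4) + 5*(42*P^2*(5^K*q)^2-441*(5^K*q)^4) := by ring
        rw [e]; exact dvd_add h (dvd_mul_right _ _)
      have := hp5.dvd_of_dvd_pow this
      rw [hP] at this
      have h' : (5:ℤ) ∣ 5^(K+1)*p := ⟨5^K*p, by ring⟩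
      have := (Int.dvd_add_left h').1 this
      norm_num at this

lemma five_iter (z : ℤ√(-105)) (h1 : (5:ℤ) ∣ z.re - 1) (h3 : ¬ (5:ℤ) ∣ z.im) (K : ℕ) :
    (5:ℤ)^(K+1) ∣ (z^(5^K)).re - 1 ∧ (5:ℤ)^K ∣ (z^(5^K)).im ∧ ¬ (5:ℤ)^(K+1) ∣ (z^(5^K)).im := by
  induction K with
  | zero => simpa using ⟨h1, h3⟩
  | succ K ih =>
    obtain ⟨i1, i2, i3⟩ := ih
    rw [pow_succ 5 K, pow_mul]
    exact five_pow _ K i1 i2 i3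

lemma five_mul (z : ℤ√(-105)) (K : ℕ) (h1 : (5:ℤ)^(K+1) ∣ z.re - 1) (h2 : (5:ℤ)^K ∣ z.im) (m : ℕ) :
    (5:ℤ)^(K+1) ∣ (z^m).re - 1 ∧ (5:ℤ)^(K+1) ∣ (z^m).im - m * z.im := by
  induction m with
  | zero => simp
  | succ m ih =>
    obtain ⟨⟨a, ha⟩, ⟨b, hb⟩⟩ := ih
    obtain ⟨c, hc⟩ := h1
    obtain ⟨d, hd⟩ := h2
    rw [pow_succ z m, Zsqrtd.re_mul, Zsqrtd.im_mul]
    have ha' : (z^m).re = 1 + 5^(K+1)*a := by linarith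
    have hb' : (z^m).im = m*(5^K*d) + 5^(K+1)*b := by rw [← hd]; linarith
    have hc' : z.re = 1 + 5^(K+1)*c := by linarith
    rw [ha', hb', hc', hd]
    push_cast
    generalize hT : (5:ℤ)^K = T at *
    rw [show (5:ℤ)^(K+1) = 5*T by rw [← hT]; ring]
    constructor
    · exact ⟨a + c + 5*T*a*c - 21*(m*(T*d)+5*T*b)*d, by ring⟩
    · exact ⟨a*T*d + b+ (m*(T*d)+5*T*b)*c, by ring⟩

lemma even_part (a w : ℤ) (hw : 2*w = 3*a^2-35) (k : ℕ) (hk : 0 < k)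
    (h : 3*a*((⟨w, a⟩ : ℤ√(-105))^(2*k)).im + ((⟨w, a⟩ : ℤ√(-105))^(2*k)).re = 1) : False := by
  have hp5 : Prime (5:ℤ) := by norm_num
  rw [pow_mul] at h
  have hz : (⟨w, a⟩ : ℤ√(-105))^2 = ⟨w^2-105*a^2, 2*a*w⟩ := by
    rw [pow_two, Zsqrtd.ext_iff]; simp; constructor <;> ring
  rw [hz] at h
  by_cases ha : (5:ℤ) ∣ a
  · have hw5 : (5:ℤ) ∣ w := by
      obtain ⟨c, rfl⟩ := ha
      have : 2*w = 5*(15*c^2-7) := by rw [hw]; ring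
      omega
    obtain ⟨c, rfl⟩ := ha
    obtain ⟨e, rfl⟩ := hw5
    obtain ⟨k, rfl⟩ : ∃ j, k = j+1 := ⟨k-1, by omega⟩
    rw [pow_succ, Zsqrtd.re_mul, Zsqrtd.im_mul] at h
    generalize ((⟨_, _⟩ : ℤ√(-105))^k) = z at h
    have : (5:ℤ) ∣ 1 := by
      rw [← h]
      refine ⟨3*c*(z.re*(2*(5*c)*(5*e))+z.im*((5*e)^2-105*(5*c)^2)) + z.re*(5*e^2-105*5*c^2) -21*z.im*(2*(5*c)*(5*e)), ?_⟩
      simp only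
      ring
    norm_num at this
  · have hww : ¬ (5:ℤ) ∣ w := by
      intro h5
      have : (5:ℤ) ∣ 3*a^2 := by
        have : 3*a^2 = 2*w+5*7 := by linarith
        rw [this]; exact dvd_add (h5.mul_left _) (dvd_mul_right _ _)
      rcases hp5.dvd_or_dvd this with h | h
      · norm_num at h
      · exact ha (hp5.dvd_of_dvd_pow h)
    have hre : (5:ℤ) ∣ w^2-105*a^2-1 := by
      have h1 := cast3 (q := 5) ha
      have hw' := congrArg (Int.cast : ℤ → ZMod 5) hw
      have := (ZMod.intCast_zmod_eq_zero_iff_dvd (w^2-105*a^2-1) 5)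
      rw [← Nat.cast_ofNat, ← this]
      push_cast at hw' ⊢
      generalize (a : ZMod 5) = a at *
      generalize (w : ZMod 5) = w at *
      clear this
      revert a w
      decide
    have him : ¬ (5:ℤ) ∣ 2*a*w := by
      intro h
      rcases hp5.dvd_or_dvd h with h | h
      · rcases hp5.dvd_or_dvd h with h | h
        · norm_num at h
        · exact ha h
      · exact hww h
    obtain ⟨K, m, hm, rfl⟩ := Nat.exists_eq_pow_mul_and_not_dvd hk.ne' 5 (by norm_num)
    rw [pow_mul] at h
    obtain ⟨i1, i2, i3⟩ := five_iter ⟨w^2-105*a^2, 2*a*w⟩ hre him K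
    generalize (⟨w^2-105*a^2, 2*a*w⟩ : ℤ√(-105))^(5^K) = z at *
    obtain ⟨j1, j2⟩ := five_mul z K i1 i2 m
    have : (5:ℤ)^(K+1) ∣ 3*a*m*z.im := by
      have e : 3*a*m*z.im = -((z^m).re-1) - 3*a*((z^m).im - m*z.im) := by linarith
      rw [e]
      exact dvd_sub (dvd_neg.2 j1) (j2.mul_left _)
    obtain ⟨d, hd⟩ := i2
    rw [hd] at this i3
    have h5 : (5:ℤ) ∣ 3*a*m*d := by
      have : (5:ℤ)^K*5 ∣ 5^K*(3*a*m*d) := by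
        have e : (5:ℤ)^K*(3*a*m*d) = 3*a*m*(5^K*d) := by ring
        rw [e, ← pow_succ]; exact this
      exact (mul_dvd_mul_iff_left (by positivity)).1 this
    rcases hp5.dvd_or_dvd h5 with h | h
    · rcases hp5.dvd_or_dvd h with h | h
      · rcases hp5.dvd_or_dvd h with h | h
        · norm_num at h
        · exact ha h
      · exact hm (by exact_mod_cast h)
    · apply i3
      rw [pow_succ]
      exact mul_dvd_mul_left _ h

lemma final_part (a w e : ℤ) (hw : 2*w = 3*a^2-35) (r : ℕ) (hr : 0 < r) (he : e = 1 ∨ e = -1)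
    (h : 3*a*((⟨w, a⟩ : ℤ√(-105))^r).im + ((⟨w, a⟩ : ℤ√(-105))^r).re = e) : False := by
  have h3 : ∀ r : ℕ, (3:ℤ) ∣ ((⟨w, a⟩ : ℤ√(-105))^r).re - (-1)^r := by
    intro r
    induction r with
    | zero => simp
    | succ r ih =>
      obtain ⟨c, hc⟩ := ih
      have hw3 : ∃ d, w = -1 + 3*d := ⟨(w+1)/3, by omega⟩
      obtain ⟨d, hd⟩ := hw3
      rw [pow_succ, Zsqrtd.re_mul]
      simp only
      have : ((⟨w, a⟩ : ℤ√(-105))^r).re = (-1)^r + 3*c := by linarith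
      rw [this]
      generalize ((⟨w, a⟩ : ℤ√(-105))^r).im = i
      rw [hd]
      exact ⟨(-1)^r*d - c + 3*c*d - 35*i*a, by ring⟩
  have h3r := h3 r
  rcases Nat.even_or_odd' r with ⟨k, rfl | rfl⟩
  · rw [pow_mul (-1 : ℤ)] at h3r
    simp only [even_two, Even.neg_pow, one_pow] at h3r
    refine even_part a w hw k (by omega) ?_
    rcases he with rfl | rfl
    · exact h
    · exfalso
      rw [mul_assoc] at h
      omega
  · rw [pow_succ (-1 : ℤ), pow_mul (-1 : ℤ)] at h3r
    simp only [even_two, Even.neg_pow, one_pow] at h3r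
    refine odd_part a w hw k ?_
    rcases he with rfl | rfl
    · exfalso
      rw [mul_assoc] at h
      omega
    · exact h

lemma norm_mk (a b : ℤ) : (⟨a, b⟩ : ℤ√(-105)) * star ⟨a, b⟩ = ((a^2+105*b^2 : ℤ) : ℤ√(-105)) := by
  rw [← Zsqrtd.norm_eq_mul_conj, Zsqrtd.norm_def]
  congr 1
  ring

lemma im_dvd (w t : ℤ) (r : ℕ) : t ∣ ((⟨w, t⟩ : ℤ√(-105))^r).im := by
  induction r with
  | zero => simp
  | succ r ih =>
    rw [pow_succ, Zsqrtd.im_mul]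
    exact dvd_add (dvd_mul_left _ _) (ih.mul_right _)

lemma int_cancel {c : ℤ} (hc : c ≠ 0) {z w : ℤ√(-105)} (h : (c : ℤ√(-105)) * z = c * w) : z = w :=
  Zsqrtd.eq_of_smul_eq_smul_left hc h

lemma unit_of_coprime {N : ℕ} {c : ℤ} (h : IsCoprime c (N:ℤ)) : IsUnit ((c:ℤ) : ZMod N) := by
  obtain ⟨u, v, huv⟩ := h
  have := congrArg (Int.cast : ℤ → ZMod N) huv
  push_cast at this
  rw [ZMod.natCast_self, mul_zero, add_zero] at this
  exact IsUnit.of_mul_eq_one_right _ this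

/-- The key factorization. -/
lemma gamma_eq (X u v w : ℤ) (y r : ℕ) (hy : 0 < y) (h : 3*X^2+35 = 2*(y:ℤ)^(2*r+1))
    (hcop : IsCoprime (6*X) (y:ℤ)) (hw : 2*w = 3*u^2-35*v^2) (huv : 3*u^2+35*v^2 = 2*y)
    (γ : ℤ√(-105)) (hγ : (⟨3*X, 1⟩ : ℤ√(-105)) = ⟨3*u, v⟩ * γ) (hn : γ * star γ = (y:ℤ√(-105))^(2*r)) :
    γ = (⟨w, u*v⟩ : ℤ√(-105))^r ∨ γ = -(⟨w, u*v⟩ : ℤ√(-105))^r := by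
  set G : ℤ√(-105) := ⟨w, u*v⟩ with hG
  set N : ℕ := y^(2*r) with hN
  have hN0 : 0 < N := by positivity
  have hBG : (⟨3*u, v⟩ : ℤ√(-105))*⟨3*u, v⟩ = 6*G := by
    rw [Zsqrtd.ext_iff]; simp [hG]; constructor
    · linarith
    · ring
  have hGn : G * star G = (y:ℤ√(-105))^2 := by
    have e1 : G * star G = ((w^2+105*(u*v)^2 : ℤ) : ℤ√(-105)) := by
      rw [hG, norm_mk]
    have e2 : w^2+105*(u*v)^2 = (y:ℤ)^2 := by nlinarith
    rw [e1, e2]; push_cast; rfl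
  have hX : ((3*X : ℤ) : ZMod N) * ((3*X : ℤ) : ZMod N) = ((-105 : ℤ) : ZMod N) := by
    have : (3*X)*(3*X) = -105 + (N:ℤ)*(6*y) := by
      rw [hN]; push_cast; rw [pow_succ] at h; linear_combination 3*h
    rw [← Int.cast_mul, this]
    rw [Int.cast_add, Int.cast_mul, Int.cast_natCast, ZMod.natCast_self]; simp
  have hcopN : IsCoprime (6*X) (N:ℤ) := by
    rw [hN]; push_cast; exact hcop.pow_right
  have hU : IsUnit ((6*X : ℤ) : ZMod N) := unit_of_coprime hcopN
  let f1 : ℤ√(-105) →+* ZMod N := Zsqrtd.lift ⟨-((3*X : ℤ) : ZMod N), by rw [neg_mul_neg]; exact hX⟩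
  let f2 : ℤ√(-105) →+* ZMod N := Zsqrtd.lift ⟨((3*X : ℤ) : ZMod N), hX⟩
  have f12 : ∀ z, f1 (star z) = f2 z := by
    intro z; simp [f1, f2, Zsqrtd.lift_apply_apply]
  have hfy1 : f1 ((y:ℤ√(-105))^(2*r)) = 0 := by
    rw [map_pow, map_natCast, ← Nat.cast_pow, ← hN, ZMod.natCast_self]
  have hfy2 : f2 ((y:ℤ√(-105))^(2*r)) = 0 := by
    rw [map_pow, map_natCast, ← Nat.cast_pow, ← hN, ZMod.natCast_self]
  have hu2 : IsUnit (f2 ⟨3*u, v⟩ * f2 γ) := by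
    rw [← map_mul, ← hγ]
    have : f2 ⟨3*X, 1⟩ = ((6*X : ℤ) : ZMod N) := by
      simp only [f2, Zsqrtd.lift_apply_apply]; push_cast; ring
    rw [this]; exact hU
  have huB : IsUnit (f2 ⟨3*u, v⟩) := isUnit_of_mul_isUnit_left hu2
  have huγ : IsUnit (f2 γ) := isUnit_of_mul_isUnit_right hu2
  have huG : IsUnit (f2 G) := by
    have := huB.mul huB
    rw [← map_mul, hBG, map_mul] at this
    exact isUnit_of_mul_isUnit_right this
  have z1 : f1 γ = 0 := by
    have := congrArg f1 hn
    rw [map_mul, f12, hfy1] at this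
    exact (huγ.mul_left_eq_zero).1 this
  have z2 : f2 (star G ^ r) = 0 := by
    have h2 : G^r * star G^r = (y:ℤ√(-105))^(2*r) := by rw [← mul_pow, hGn, ← pow_mul]
    have := congrArg f2 h2
    rw [map_mul, hfy2, map_pow] at this
    exact ((huG.pow r).mul_right_eq_zero).1 this
  set z := γ * star G ^ r with hz
  have e1 : f1 z = 0 := by rw [hz, map_mul, z1, zero_mul]
  have e2 : f2 z = 0 := by rw [hz, map_mul, z2, mul_zero]
  have him : ((z.im : ℤ) : ZMod N) = 0 := by
    have : ((6*X : ℤ) : ZMod N) * z.im = 0 := by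
      have : f2 z - f1 z = 0 := by rw [e1, e2, sub_zero]
      rw [← this]
      simp only [f1, f2, Zsqrtd.lift_apply_apply]; push_cast; ring
    exact (hU.mul_right_eq_zero).1 this
  have hre : ((z.re : ℤ) : ZMod N) = 0 := by
    have := e2
    simp only [f2, Zsqrtd.lift_apply_apply] at this
    rw [him] at this; simpa using this
  rw [ZMod.intCast_zmod_eq_zero_iff_dvd] at him hre
  obtain ⟨c, hc⟩ := hre
  obtain ⟨d, hd⟩ := him
  have hzδ : z = ((N:ℤ) : ℤ√(-105)) * ⟨c, d⟩ := by
    rw [Zsqrtd.ext_iff]; simp; exact ⟨hc, hd⟩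
  have hNr : ((N:ℤ) : ℤ√(-105)) = (y:ℤ√(-105))^(2*r) := by rw [hN]; push_cast; rfl
  have hnz : z.norm = (N:ℤ)^2 := by
    have : ((z.norm : ℤ) : ℤ√(-105)) = (((N:ℤ)^2 : ℤ) : ℤ√(-105)) := by
      rw [Zsqrtd.norm_eq_mul_conj, hz, star_mul, star_pow, star_star]
      calc γ * star G ^ r * (G^r * star γ) = (γ * star γ) * (G * star G)^r := by rw [mul_pow]; ring
        _ = _ := by rw [hn, hGn, ← pow_mul]; push_cast; rw [← Int.cast_natCast (R := ℤ√(-105)) N, hNr]; ring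
    exact_mod_cast this
  have hcd : c^2+105*d^2 = 1 := by
    rw [Zsqrtd.norm_def, hc, hd] at hnz
    have : (N:ℤ)^2*(c^2+105*d^2) = (N:ℤ)^2*1 := by linear_combination hnz
    exact mul_left_cancel₀ (by positivity) this
  have hd0 : d = 0 := by
    by_contra hne
    have : 0 < d^2 := by positivity
    nlinarith [sq_nonneg c]
  subst hd0
  have hfin : γ = ⟨c, 0⟩ * G^r := by
    apply int_cancel (c := (N:ℤ)) (by positivity)
    rw [← mul_assoc, ← hzδ, hz, hNr, pow_mul, ← hGn, mul_pow]; ring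
  have hc1 : c = 1 ∨ c = -1 := by
    have : (c-1)*(c+1) = 0 := by linarith
    rcases mul_eq_zero.1 this with h | h <;> omega
  rcases hc1 with rfl | rfl
  · left; rw [hfin]; exact one_mul _
  · right; rw [hfin]
    have : (⟨-1, 0⟩ : ℤ√(-105)) = -1 := by rw [Zsqrtd.ext_iff]; simp
    rw [this, neg_one_mul]

lemma descent (m : ℤ) (y r : ℕ) (hr : 0 < r) (h : 3*(2*m+1)^2+35 = 2*(y:ℤ)^(2*r+1)) : False := by
  have hpow : ∀ q : ℤ, q ∣ y → q^2 ∣ (y:ℤ)^(2*r+1) := by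
    intro q hq
    exact (pow_dvd_pow_of_dvd hq 2).trans (pow_dvd_pow _ (by omega))
  have hy : 0 < y := by
    rcases Nat.eq_zero_or_pos y with rfl | h0
    · rw [Nat.cast_zero, zero_pow (by omega)] at h
      nlinarith [sq_nonneg (2*m+1)]
    · exact h0
  have hy2 : ¬ (2:ℤ) ∣ y := by
    intro hd
    obtain ⟨c, hc⟩ := hpow 2 hd
    rw [hc] at h
    ring_nf at h
    omega
  have hy3 : ¬ (3:ℤ) ∣ y := by
    intro hd
    obtain ⟨c, hc⟩ := hpow 3 hd
    rw [hc] at h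
    ring_nf at h
    omega
  have hy5 : ¬ (5:ℤ) ∣ y := by
    intro hd
    obtain ⟨c, hc⟩ := hpow 5 hd
    rw [hc] at h
    have hp : Prime (5:ℤ) := by norm_num
    have h1 : (5:ℤ) ∣ (2*m+1)^2 := by
      generalize (2*m+1)^2 = t at h; omega
    obtain ⟨e, he⟩ := hp.dvd_of_dvd_pow h1
    rw [he] at h
    ring_nf at h
    omega
  have hy7 : ¬ (7:ℤ) ∣ y := by
    intro hd
    obtain ⟨c, hc⟩ := hpow 7 hd
    rw [hc] at h
    have hp : Prime (7:ℤ) := by norm_num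
    have h1 : (7:ℤ) ∣ (2*m+1)^2 := by
      generalize (2*m+1)^2 = t at h; omega
    obtain ⟨e, he⟩ := hp.dvd_of_dvd_pow h1
    rw [he] at h
    ring_nf at h
    omega
  have c2 : IsCoprime (2:ℤ) y := (Prime.coprime_iff_not_dvd (by norm_num)).2 hy2
  have c3 : IsCoprime (3:ℤ) y := (Prime.coprime_iff_not_dvd (by norm_num)).2 hy3
  have c5 : IsCoprime (5:ℤ) y := (Prime.coprime_iff_not_dvd (by norm_num)).2 hy5
  have c7 : IsCoprime (7:ℤ) y := (Prime.coprime_iff_not_dvd (by norm_num)).2 hy7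
  have cX : IsCoprime (2*m+1) (y:ℤ) := by
    obtain ⟨a, b, hab⟩ := c5.mul_left c7
    refine ⟨-3*(2*m+1)*a, b + 2*(y:ℤ)^(2*r)*a, ?_⟩
    rw [pow_succ] at h
    linear_combination hab - a*h
  have c6X : IsCoprime (6*(2*m+1)) (y:ℤ) := by
    have := (c2.mul_left c3).mul_left cX
    norm_num at this; exact this
  have hyr : ∀ p : ℤ, Prime p → ¬ p ∣ (y:ℤ) → ¬ p ∣ (y:ℤ)^r := fun p hp h1 h2 =>
    h1 (hp.dvd_of_dvd_pow h2)
  obtain ⟨s, v, hsv⟩ := forms_red ((y:ℤ)^r) (hyr 3 (by norm_num) hy3) (hyr 5 (by norm_num) hy5)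
    (hyr 7 (by norm_num) hy7) (3*y) (3*(y:ℤ)) (3*(2*m+1)) (2*(y:ℤ)^(2*r)) (by positivity)
    (by push_cast; rfl) (by rw [pow_succ] at h; linear_combination -3*h) ⟨0, 1, by rw [← pow_mul, mul_comm r 2]; ring⟩
  set X := 2*m+1 with hX
  obtain ⟨u, hu⟩ : ∃ u, u = X*v+y*s := ⟨_, rfl⟩
  have huv : 3*u^2+35*v^2 = 2*y := by
    rw [hu, pow_succ] at *
    linear_combination (y:ℤ)*hsv + v^2*h
  have hyo : (y:ℤ) % 2 = 1 := by omega
  have par : u % 2 = 1 ∧ v % 2 = 1 := by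
    rcases Int.even_or_odd' u with ⟨a, rfl | rfl⟩ <;> rcases Int.even_or_odd' v with ⟨b, rfl | rfl⟩ <;>
      ring_nf at huv <;> omega
  have hs : s % 2 = 0 := by
    obtain ⟨p1, p2⟩ := par
    rcases Int.even_or_odd' s with ⟨a, rfl | rfl⟩
    · omega
    · exfalso
      obtain ⟨b, hb⟩ : ∃ b, v = 2*b+1 := ⟨v/2, by omega⟩
      obtain ⟨c, hc⟩ : ∃ c, (y:ℤ) = 2*c+1 := ⟨(y:ℤ)/2, by omega⟩
      rw [hb, hc, hX] at hu
      ring_nf at hu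
      omega
  obtain ⟨t, rfl⟩ : ∃ t, s = 2*t := ⟨s/2, by omega⟩
  obtain ⟨w, hw⟩ : ∃ w, 2*w = 3*u^2-35*v^2 := ⟨u^2*3-35*v^2-(y:ℤ)+35*v^2 , by linarith⟩
  obtain ⟨γ, hγd⟩ : ∃ γ : ℤ√(-105), γ = ⟨(y:ℤ)^(2*r)*v+3*X*t, t⟩ := ⟨_, rfl⟩
  have hγ : (⟨3*X, 1⟩ : ℤ√(-105)) = ⟨3*u, v⟩ * γ := by
    rw [pow_succ] at h
    rw [hγd, Zsqrtd.ext_iff]; simp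
    rw [hu]
    constructor
    · apply mul_left_cancel₀ (show (2:ℤ) ≠ 0 by norm_num)
      linear_combination (-3*X)*hsv + 6*t*v*h
    · apply mul_left_cancel₀ (show (2:ℤ) ≠ 0 by norm_num)
      linear_combination (-1)*hsv
  have hn : γ * star γ = (y:ℤ√(-105))^(2*r) := by
    have e1 : γ * star γ = (((y:ℤ)^(2*r)*v+3*X*t)^2+105*t^2 : ℤ) := by
      rw [hγd, norm_mk]
    have e2 : ((y:ℤ)^(2*r)*v+3*X*t)^2+105*t^2 = (y:ℤ)^(2*r) := by
      rw [pow_succ] at h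
      apply mul_left_cancel₀ (show (2:ℤ) ≠ 0 by norm_num)
      linear_combination (y:ℤ)^(2*r)*hsv + 6*t^2*h
    rw [e1, e2]; push_cast; rfl
  have key := gamma_eq X u v w y r hy h c6X hw huv γ hγ hn
  have him := congrArg Zsqrtd.im hγ
  rw [Zsqrtd.im_mul] at him
  simp only at him
  obtain ⟨c, hc⟩ := im_dvd w (u*v) r
  have : ∃ e : ℤ, (e = 1 ∨ e = -1) ∧ 3*u*((⟨w, u*v⟩ : ℤ√(-105))^r).im + v*((⟨w, u*v⟩ : ℤ√(-105))^r).re = e := by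
    rcases key with k | k
    · exact ⟨1, Or.inl rfl, by rw [k] at him; linarith⟩
    · exact ⟨-1, Or.inr rfl, by rw [k] at him; simp only [Zsqrtd.im_neg, Zsqrtd.re_neg] at him; linarith⟩
  obtain ⟨e, he, heq⟩ := this
  have hv : v = 1 ∨ v = -1 := by
    have : v ∣ e := ⟨3*u*u*c + ((⟨w, u*v⟩ : ℤ√(-105))^r).re, by rw [← heq, hc]; ring⟩
    have : v ∣ 1 := by rcases he with rfl | rfl; exacts [this, by simpa using this]
    exact Int.isUnit_iff.1 (isUnit_of_dvd_one this)
  refine final_part (u*v) w (e*v) ?_ r hr ?_ ?_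
  · rcases hv with rfl | rfl <;> linarith
  · rcases hv with rfl | rfl <;> rcases he with rfl | rfl <;> simp
  · rw [← heq]
    have : v*v = 1 := by rcases hv with rfl | rfl <;> norm_num
    linear_combination (-((⟨w, u*v⟩ : ℤ√(-105))^r).re)*this

/-- The sum of 6 consecutive squares is never a perfect `n`-th power, `n ≥ 2`. -/
theorem no_power_sum_six_consecutive_squares (n : ℕ) (hn : 2 ≤ n) (x y : ℤ) :
    ∑ i ∈ Finset.range 6, (x + (i : ℤ) + 1) ^ 2 ≠ y ^ n := by
  intro h
  have h' : 6*x^2+42*x+91 = y^n := by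
    rw [← h]; simp [Finset.sum_range_succ]; ring
  rcases Nat.even_or_odd' n with ⟨r, rfl | rfl⟩
  · rw [mul_comm 2 r, pow_mul] at h'
    generalize y^r = z at h'
    have := congrArg (Int.cast : ℤ → ZMod 4) h'
    push_cast at this
    generalize (x : ZMod 4) = x at this
    generalize (z : ZMod 4) = z at this
    revert x z
    decide
  · have hy : 0 ≤ y := by
      by_contra hneg
      have : y^(2*r+1) < 0 := Odd.pow_neg ⟨r, rfl⟩ (by omega)
      nlinarith [sq_nonneg (2*x+7)]
    lift y to ℕ using hy
    exact descent (x+3) y r (by omega) (by rw [← h']; ring)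
end

section
/- Let 2 ≤ d ≤ 10, and let x, y, n be integers with n ≥ 3 satisfying (x+1)² + ... + (x+d)² = yⁿ. Then d = 2 and (x, y, n) is one of: (−1, ±1, n) with n even, (−2, ±1, n) with n even, (−1, 1, n) with n odd, (−2, 1, n) with n odd, (118, ±13, 4), (−121, ±13, 4). -/
theorem sq_form_reduce (D : ℤ) (hD : 0 < D) : ∀ (N : ℕ) (A B C : ℤ), 0 < A → A.toNat ≤ N → A * C - B ^ 2 = D →
    ∃ p q r s A' B' C' : ℤ, p * s - q * r = 1 ∧ A' = A * p ^ 2 + 2 * B * p * r + C * r ^ 2 ∧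
      B' = A * p * q + B * (p * s + q * r) + C * r * s ∧
      C' = A * q ^ 2 + 2 * B * q * s + C * s ^ 2 ∧ 0 < A' ∧ 2 * B' ≤ A' ∧ -A' ≤ 2 * B' ∧ A' ≤ C' ∧
      A' * C' - B' ^ 2 = D := by
  intro N
  induction N with
  | zero => intro A B C hA hN; omega
  | succ N ih =>
    intro A B C hA hN h
    -- translate
    obtain ⟨t, ht1, ht2⟩ : ∃ t : ℤ, 2 * (B + A * t) ≤ A ∧ -A ≤ 2 * (B + A * t) := by
      refine ⟨-((2 * B + A) / (2 * A)), ?_, ?_⟩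
      · have := Int.emod_add_mul_ediv (2 * B + A) (2 * A)
        have h2 := Int.emod_lt_of_pos (2 * B + A) (by omega : 0 < 2 * A)
        nlinarith
      · have := Int.emod_add_mul_ediv (2 * B + A) (2 * A)
        have h2 := Int.emod_nonneg (2 * B + A) (by omega : 2 * A ≠ 0)
        nlinarith
    by_cases hc : A ≤ A * t ^ 2 + 2 * B * t + C
    · refine ⟨1, t, 0, 1, _, _, _, by ring, rfl, rfl, rfl, ?_, ?_, ?_, ?_, ?_⟩
      · simpa using hA
      · linarith
      · linarith
      · linarith
      · rw [← h]; ring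
    · push Not at hc
      have hC : 0 < A * t ^ 2 + 2 * B * t + C := by
        have : A * (A * t ^ 2 + 2 * B * t + C) = (B + A * t) ^ 2 + D := by rw [← h]; ring
        by_contra hcon
        push Not at hcon
        nlinarith [sq_nonneg (B + A * t)]
      obtain ⟨p, q, r, s, A', B', C', h1, h2, h3, h4, h5⟩ := ih (A * t ^ 2 + 2 * B * t + C) (-(B + A * t)) A hC
        (by omega) (by rw [← h]; ring)
      refine ⟨t * p - r, t * q - s, p, q, A', B', C', ?_, ?_, ?_, ?_, h5⟩
      · rw [← h1]; ring
      · rw [h2]; ring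
      · rw [h3]; ring
      · rw [h4]; ring

theorem gen_div (d T c y e f : ℤ) (n : ℕ) (hy : y ≠ 0) (hT : T ^ 2 - d = c * y ^ n)
    (hn : e ^ 2 - d * f ^ 2 = c * y) (hJ : y ∣ e - T * f) :
    ∃ g h : ℤ, g ^ 2 - d * h ^ 2 = c ^ (n + 1) ∧
      (c : ℤ√d) * (⟨e, f⟩ : ℤ√d) ^ n = ⟨g, h⟩ * ⟨T, 1⟩ := by
  have key : ∀ m, m ≤ n → y ^ m ∣ ((⟨e, f⟩ : ℤ√d) ^ m).re - T * ((⟨e, f⟩ : ℤ√d) ^ m).im := by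
    intro m
    induction m with
    | zero => intro _; simp
    | succ m ih =>
      intro hm
      have h1 := ih (by omega)
      rw [pow_succ (⟨e, f⟩ : ℤ√d) m]
      set z := (⟨e, f⟩ : ℤ√d) ^ m
      change y ^ (m+1) ∣ (z * (⟨e, f⟩ : ℤ√d)).re - T * (z * (⟨e, f⟩ : ℤ√d)).im
      rw [Zsqrtd.re_mul, Zsqrtd.im_mul]
      have h2 : y ^ (m + 1) ∣ T ^ 2 - d := by
        rw [hT]; exact Dvd.dvd.mul_left (pow_dvd_pow y hm) c
      have h3 : y ^ (m + 1) ∣ (z.re - T * z.im) * (e - T * f) := by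
        rw [pow_succ]; exact mul_dvd_mul h1 hJ
      have : z.re * e + d * z.im * f - T * (z.re * f + z.im * e) =
        (z.re - T * z.im) * (e - T * f) - (T ^ 2 - d) * (z.im * f) := by ring
      simp only [] at *
      rw [this]
      exact dvd_sub h3 (Dvd.dvd.mul_right h2 _)
  obtain ⟨k, hk⟩ := key n le_rfl
  have hnorm : ((⟨e, f⟩ : ℤ√d) ^ n).norm = (c * y) ^ n := by
    have : ((⟨e, f⟩ : ℤ√d)).norm = c * y := by rw [Zsqrtd.norm_def, ← hn]; ring
    rw [← this]
    exact map_pow (Zsqrtd.normMonoidHom (d := d)) _ n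
  set z := (⟨e, f⟩ : ℤ√d) ^ n with hz
  rw [Zsqrtd.norm_def] at hnorm
  refine ⟨c * z.im + k * T, -k, ?_, ?_⟩
  · have hyn : y ^ n ≠ 0 := pow_ne_zero _ hy
    have hre : z.re = T * z.im + y ^ n * k := by linarith
    rw [hre, mul_pow] at hnorm
    apply mul_left_cancel₀ hyn
    rw [pow_succ]
    linear_combination c * hnorm  + (k^2 * y^n - c * z.im ^ 2) * hT
  · have hre : z.re = T * z.im + y ^ n * k := by linarith
    ext
    · simp
      rw [hre]; linear_combination (-k) * hT
    · simp


theorem pow_parity {R : Type*} [CommRing R] (M : ℤ) (γ : R) (hM : 4 ∣ M) (hM0 : M ≠ 0) (j : ℕ) (hj : j ≠ 0) :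
    ∃ N : ℤ, N ≠ 0 ∧ ∃ δ : R, (1 + (M : R) * γ) ^ j = 1 + (N : R) * (γ + 2 * δ) := by
  obtain ⟨M', rfl⟩ := hM
  have hodd : ∀ t : ℕ, ∃ δ : R, (1 + ((4 * M' : ℤ) : R) * γ) ^ t = 1 + t * ((4 * M' : ℤ) : R) * γ + ((4 * M' : ℤ) : R) ^ 2 * δ := by
    intro t
    induction t with
    | zero => exact ⟨0, by simp⟩
    | succ t ih =>
      obtain ⟨δ, h⟩ := ih
      refine ⟨δ + t * γ ^ 2 + ((4 * M' : ℤ) : R) * δ * γ, ?_⟩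
      rw [pow_succ, h]; push_cast; ring
  obtain ⟨e, t, ht, rfl⟩ := Nat.exists_eq_two_pow_mul_odd hj
  clear hj
  suffices H : ∃ N : ℤ, 4 * N ≠ 0 ∧ ∃ δ : R, (1 + ((4 * M' : ℤ) : R) * γ) ^ (2 ^ e * t) = 1 + ((4 * N : ℤ) : R) * (γ + 2 * δ) by
    obtain ⟨N, h⟩ := H
    exact ⟨_, h⟩
  induction e with
  | zero =>
    obtain ⟨δ, h⟩ := hodd t
    obtain ⟨s, rfl⟩ := ht
    refine ⟨M', hM0, s * γ + 2 * (M' : R) * δ, ?_⟩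
    rw [pow_zero, one_mul, h]; push_cast; ring
  | succ e ih =>
    obtain ⟨N, hN, δ, h⟩ := ih
    refine ⟨2 * N, by omega, δ + N * (γ + 2 * δ) ^ 2, ?_⟩
    rw [pow_succ, mul_comm (2 ^ e) 2, mul_assoc, pow_mul', h]; push_cast; ring

theorem im_dvd_s19 (d e f c m : ℤ) (k : ℕ) : f ∣ ((⟨e, f⟩ : ℤ√d) * ⟨c, m * f⟩ ^ k).im := by
  induction k with
  | zero => simp
  | succ k ih =>
    rw [pow_succ, ← mul_assoc]
    set z := (⟨e, f⟩ : ℤ√d) * ⟨c, m * f⟩ ^ k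
    rw [Zsqrtd.im_mul]
    exact dvd_add (Dvd.dvd.mul_left (Dvd.intro_left _ rfl) _) (Dvd.dvd.mul_right ih _)

theorem form_exists (D T C y : ℤ) (hD : 0 < D) (hy : 0 < y) (h : y * C - T ^ 2 = D) :
    ∃ A B C' : ℤ, 0 < A ∧ 2 * B ≤ A ∧ -A ≤ 2 * B ∧ A ≤ C' ∧ A * C' - B ^ 2 = D ∧
      (∃ r s : ℤ, y = A * s ^ 2 - 2 * B * s * r + C' * r ^ 2) ∧
      (∃ e f : ℤ, e ^ 2 + D * f ^ 2 = A * y ∧ y ∣ e - T * f) ∧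
      (∃ e f : ℤ, e ^ 2 + D * f ^ 2 = C' * y ∧ y ∣ e - T * f) := by
  obtain ⟨p, q, r, s, A, B, C', h1, h2, h3, h4, h5, h6, h7, h8, h9⟩ := sq_form_reduce D hD y.toNat y T C hy le_rfl h
  refine ⟨A, B, C', h5, h6, h7, h8, h9, ⟨r, s, ?_⟩, ⟨r * T + y * p, r, ?_, ?_⟩, ⟨s * T + y * q, s, ?_, ?_⟩⟩
  · rw [h2, h3, h4]
    have : y = y * (p * s - q * r) ^ 2 := by rw [h1]; ring
    exact this.trans (by ring)
  · rw [h2, ← h]; ring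
  · exact ⟨p, by ring⟩
  · rw [h4, ← h]; ring
  · exact ⟨q, by ring⟩

theorem desc3 (m : ℕ) : ∀ g h : ℤ, g ^ 2 + 6 * h ^ 2 = 9 ^ m → h = 0 ∧ (g = 3 ^ m ∨ g = - 3 ^ m) := by
  induction m with
  | zero =>
    intro g h H
    have hh : h = 0 := by
      by_contra hne
      have := Int.one_le_abs hne
      nlinarith [sq_abs h, sq_nonneg g]
    subst hh
    refine ⟨rfl, ?_⟩
    have : g ^ 2 = 1 := by linarith
    simpa using this
  | succ m ih =>
    intro g h H
    have h3 : (3:ℤ) ∣ g := by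
      apply Int.prime_three.dvd_of_dvd_pow (n := 2)
      have : g ^ 2 = 3 * (3 * 9 ^ m - 2 * h ^ 2) := by rw [pow_succ _ m] at H; linarith
      exact ⟨_, this⟩
    obtain ⟨g, rfl⟩ := h3
    have h3 : (3:ℤ) ∣ h := by
      apply Int.prime_three.dvd_of_dvd_pow (n := 2)
      have : h ^ 2 = 3 * (9 ^ m - g ^ 2 ) - h ^ 2 := by rw [pow_succ _ m] at H; linarith
      omega
    obtain ⟨h, rfl⟩ := h3
    obtain ⟨h1, h2⟩ := ih g h (by rw [pow_succ _ m] at H; linarith)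
    subst h1
    refine ⟨by ring, ?_⟩
    rcases h2 with rfl | rfl
    · left; ring
    · right; ring

theorem desc6 (m : ℕ) : ∀ g h : ℤ, g ^ 2 + 105 * h ^ 2 = 36 ^ m → h = 0 ∧ (g = 6 ^ m ∨ g = - 6 ^ m) := by
  induction m with
  | zero =>
    intro g h H
    have hh : h = 0 := by
      by_contra hne
      have := Int.one_le_abs hne
      nlinarith [sq_abs h, sq_nonneg g]
    subst hh
    refine ⟨rfl, ?_⟩
    have : g ^ 2 = 1 := by linarith
    simpa using this
  | succ m ih =>
    intro g h H
    have h3 : (3:ℤ) ∣ g := by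
      apply Int.prime_three.dvd_of_dvd_pow (n := 2)
      have : g ^ 2 = 3 * (12 * 36 ^ m - 35 * h ^ 2) := by rw [pow_succ _ m] at H; linarith
      exact ⟨_, this⟩
    obtain ⟨g, rfl⟩ := h3
    have h3 : (3:ℤ) ∣ h := by
      apply Int.prime_three.dvd_of_dvd_pow (n := 2)
      have : 35 * h ^ 2 = 3 * (4 * 36 ^ m - g ^ 2 ) := by rw [pow_succ _ m] at H; linarith
      omega
    obtain ⟨h, rfl⟩ := h3
    have H2 : g ^ 2 + 105 * h ^ 2 = 4 * 36 ^ m := by rw [pow_succ _ m] at H; linarith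
    have e1 : Even g ∧ Even h := by
      rcases Int.even_or_odd' g with ⟨a, rfl | rfl⟩ <;> rcases Int.even_or_odd' h with ⟨b, rfl | rfl⟩
      · exact ⟨by simp, by simp⟩
      · exfalso; ring_nf at H2; omega
      · exfalso; ring_nf at H2; omega
      · exfalso; ring_nf at H2; omega
    obtain ⟨⟨g, rfl⟩, ⟨h, rfl⟩⟩ := e1
    obtain ⟨h1, h2⟩ := ih g h (by linarith)
    subst h1
    refine ⟨by ring, ?_⟩
    rcases h2 with rfl | rfl
    · left; ring
    · right; ring


theorem int_pow_mod' (y : ℤ) (n : ℕ) (m : ℤ) : y ^ n % m = (y % m) ^ n % m :=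
  ((Int.mod_modEq y m).symm.pow n)

theorem pow_one_add {R : Type*} [CommRing R] (M γ : R) (j : ℕ) : ∃ δ, (1 + M * γ) ^ j = 1 + M * δ := by
  induction j with
  | zero => exact ⟨0, by simp⟩
  | succ j ih =>
    obtain ⟨δ, h⟩ := ih
    exact ⟨δ + γ + M * γ * δ, by rw [pow_succ, h]; ring⟩

theorem cancel_lem (d c T : ℤ) (k : ℕ) (β ω : ℤ√d) (hc : c ≠ 0) (hω : β ^ 2 = (c : ℤ√d) * ω) (g h : ℤ)
    (h0 : h = 0) (hg : g = c ^ (k + 1) ∨ g = - c ^ (k + 1))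
    (H : (c : ℤ√d) * β ^ (2 * k + 1) = ⟨g, h⟩ * ⟨T, 1⟩) :
    β * ω ^ k = ⟨T, 1⟩ ∨ β * ω ^ k = -⟨T, 1⟩ := by
  subst h0
  have hl : (c : ℤ√d) * β ^ (2 * k + 1) = ((c ^ (k + 1) : ℤ) : ℤ√d) * (β * ω ^ k) := by
    rw [pow_succ β, pow_mul, hω]; push_cast; ring
  have hgz : (⟨g, 0⟩ : ℤ√d) = ((g : ℤ) : ℤ√d) := by ext <;> simp
  rw [hl, hgz] at H
  have hck : c ^ (k + 1) ≠ 0 := pow_ne_zero _ hc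
  rcases hg with rfl | rfl
  · left
    exact Zsqrtd.eq_of_smul_eq_smul_left hck H
  · right
    apply Zsqrtd.eq_of_smul_eq_smul_left hck
    rw [H]; push_cast; ring

theorem norm_f (d T e f c m : ℤ) (k : ℕ)
    (H : (⟨e, f⟩ : ℤ√d) * ⟨c, m * f⟩ ^ k = ⟨T, 1⟩ ∨ (⟨e, f⟩ : ℤ√d) * ⟨c, m * f⟩ ^ k = -⟨T, 1⟩) :
    f = 1 ∨ f = -1 := by
  have := im_dvd_s19 d e f c m k
  have h2 : f ∣ 1 := by
    rcases H with H | H <;> rw [H] at this <;> simpa using this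
  exact Int.isUnit_iff.mp (isUnit_of_dvd_one h2)

theorem modz {d : ℤ} (M : ℤ) (z w : ℤ√d) (h1 : M ∣ z.re - w.re) (h2 : M ∣ z.im - w.im) : (M : ℤ√d) ∣ z - w := by
  rw [Zsqrtd.intCast_dvd]; exact ⟨by simpa using h1, by simpa using h2⟩

theorem case3 (X y : ℤ) (k : ℕ) (hk : 1 ≤ k) (h : 3 * X ^ 2 + 2 = y ^ (2 * k + 1)) : False := by
  have hpos : 0 < y := by
    have : 0 < y ^ (2 * k + 1) := by rw [← h]; positivity
    exact (Odd.pow_pos_iff ⟨k, rfl⟩).mp this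
  have hyo : y % 2 = 1 := by
    rcases Int.emod_two_eq_zero_or_one y with h0 | h0
    · exfalso
      obtain ⟨t, rfl⟩ : ∃ t, y = 2 * t := ⟨y / 2, by omega⟩
      have : (4:ℤ) ∣ (2 * t) ^ (2 * k + 1) := by
        have h4 : (2 * t) ^ (2 * k + 1) = 4 * (t ^ 2 * (2 * t) ^ (2 * k - 1)) := by
          obtain ⟨j, rfl⟩ : ∃ j, k = j + 1 := ⟨k - 1, by omega⟩
          rw [show 2 * (j + 1) - 1 = 2 * j + 1 by omega]; ring
        exact ⟨_, h4⟩
      rw [← h] at this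
      rcases Int.even_or_odd' X with ⟨a, rfl | rfl⟩ <;> ring_nf at this <;> omega
    · exact h0
  have hy3 : y % 3 = 2 := by
    have h1 : y ^ (2 * k + 1) % 3 = 2 := by rw [← h]; omega
    have h2 : y % 3 = 0 ∨ y % 3 = 1 ∨ y % 3 = 2 := by omega
    rcases h2 with h2 | h2 | h2
    · rw [int_pow_mod', h2] at h1; simp at h1
    · rw [int_pow_mod', h2] at h1; simp at h1
    · exact h2
  have hT : (3 * X) ^ 2 - (-6) = 3 * y ^ (2 * k + 1) := by rw [← h]; ring
  obtain ⟨A, B, C', hA, hB1, hB2, hAC, hdet, ⟨r, s, hrs⟩, -, ⟨e, f, hef, hdv⟩⟩ :=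
    form_exists 6 (3 * X) (3 * y ^ (2 * k)) y (by norm_num) hpos (by rw [pow_succ y] at hT; linarith)
  have hA2 : A ≤ 2 := by nlinarith
  have hC3 : C' = 3 := by
    interval_cases A
    · have hB : B = 0 := by omega
      subst hB
      have hC : C' = 6 := by linarith
      subst hC
      exfalso
      have h1 : y % 3 = (s ^ 2) % 3 := by rw [hrs]; ring_nf; omega
      rw [hy3] at h1
      rcases (by omega : s % 3 = 0 ∨ s % 3 = 1 ∨ s % 3 = 2) with h2 | h2 | h2 <;>
        rw [int_pow_mod', h2] at h1 <;> simp at h1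
    · have hB : B = 0 ∨ B = 1 ∨ B = -1 := by omega
      rcases hB with rfl | rfl | rfl <;> omega
  subst hC3
  obtain ⟨g, h', hgh, H⟩ := gen_div (-6) (3 * X) 3 y e f (2 * k + 1) hpos.ne' hT (by linarith) hdv
  obtain ⟨h0, hg⟩ := desc3 (k + 1) g h' (by
    rw [show (9:ℤ) = 3 ^ 2 by norm_num, ← pow_mul, show 2 * (k + 1) = 2 * k + 1 + 1 by ring, ← hgh]; ring)
  obtain ⟨a, rfl⟩ : (3:ℤ) ∣ e := by
    apply Int.prime_three.dvd_of_dvd_pow (n := 2)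
    exact ⟨y - 2 * f ^ 2, by linarith⟩
  have H2 := cancel_lem (-6) 3 (3 * X) k ⟨3 * a, f⟩ ⟨3 * a ^ 2 - 2 * f ^ 2, 2 * a * f⟩ (by norm_num) (by
    rw [pow_two]
    ext
    · simp; ring
    · simp; ring) g h' h0 hg H
  have hf := norm_f _ _ _ _ _ _ _ H2
  have hf2 : f ^ 2 = 1 := by rcases hf with rfl | rfl <;> norm_num
  have hya : y = 3 * a ^ 2 + 2 := by rw [hf2] at hef; linarith
  obtain ⟨b, hba, hb⟩ : ∃ b : ℤ, b ^ 2 = a ^ 2 ∧ ∃ Z : ℤ√(-6), ((⟨3 * b, 1⟩ : ℤ√(-6)) * ⟨3 * b ^ 2 - 2, 2 * b⟩ ^ k) = Z ∧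
      (Z.im = 1 ∨ Z.im = -1) := by
    rcases hf with rfl | rfl
    · refine ⟨a, rfl, _, rfl, ?_⟩
      simp only [one_pow, mul_one] at H2
      rcases H2 with H2 | H2 <;> rw [H2] <;> simp
    · refine ⟨-a, by ring, _, rfl, ?_⟩
      have e1 : (⟨3 * -a, 1⟩ : ℤ√(-6)) = -⟨3 * a, -1⟩ := by ext <;> simp
      have e2 : (⟨3 * (-a) ^ 2 - 2, 2 * -a⟩ : ℤ√(-6)) = ⟨3 * a ^ 2 - 2 * (-1) ^ 2, 2 * a * -1⟩ := by ext <;> simp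
      rw [e1, e2, neg_mul]
      rcases H2 with H2 | H2 <;> rw [H2] <;> simp
  rw [← hba] at hya
  clear H2 hf hf2 hef hdv H hgh hT hg hba hrs
  obtain ⟨Z, hZ, hZ1⟩ := hb
  have hbo : b % 2 = 1 := by
    rcases Int.even_or_odd' b with ⟨c, rfl | rfl⟩ <;> ring_nf at hya <;> omega
  obtain ⟨c, hc⟩ : ∃ c, b ^ 2 = 8 * c + 1 := by
    have := Int.sq_mod_four_eq_one_of_odd (Int.odd_iff.mpr hbo)
    have := Int.eight_dvd_sq_sub_one_of_odd (Int.odd_iff.mpr hbo)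
    obtain ⟨c, hc⟩ := this
    exact ⟨c, by linarith⟩
  -- mod 3
  have hZ2 : Z.im = 1 := by
    have h1 : ∀ j, ((⟨3 * b ^ 2 - 2, 2 * b⟩ : ℤ√(-6)) ^ j).re % 3 = 1 := by
      intro j
      induction j with
      | zero => simp
      | succ j ih =>
        rw [pow_succ, Zsqrtd.re_mul]
        simp only []
        generalize ((⟨3 * b ^ 2 - 2, 2 * b⟩ : ℤ√(-6)) ^ j).im = q at *
        generalize ((⟨3 * b ^ 2 - 2, 2 * b⟩ : ℤ√(-6)) ^ j).re = p at *
        have : p * (3 * b ^ 2 - 2) + -6 * q * (2 * b) = p + 3 * (p * b ^ 2 - p - 4 * q * b) := by ring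
        rw [this]; omega
    have h2 := h1 k
    rw [← hZ, Zsqrtd.im_mul] at hZ1 ⊢
    simp only [one_mul] at hZ1 ⊢
    rw [mul_assoc] at hZ1 ⊢
    omega
  clear hZ1
  set ω : ℤ√(-6) := ⟨3 * b ^ 2 - 2, 2 * b⟩ with hω
  have hω2 : ω ^ 2 = 1 + ((4:ℤ) : ℤ√(-6)) * ⟨144 * c ^ 2 - 36 * c - 6, b * (24 * c + 1)⟩ := by
    rw [pow_two]
    ext
    · simp [hω]; rw [mul_right_comm, ← pow_two]; linear_combination (9 * (b ^ 2 + 8 * c + 1) - 36) * hc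
    · simp [hω]; linear_combination (12 * b) * hc
  obtain ⟨j, rfl | rfl⟩ := Nat.even_or_odd' k
  · obtain ⟨N, hN, δ, hδ⟩ := pow_parity (R := ℤ√(-6)) 4 ⟨144 * c ^ 2 - 36 * c - 6, b * (24 * c + 1)⟩ (by norm_num) (by norm_num) j (by omega)
    rw [pow_mul, hω2, hδ] at hZ
    rw [← hZ] at hZ2
    simp at hZ2
    have h0 : N * (3 * b * (b * (24 * c + 1) + 2 * δ.im) + (144 * c ^ 2 - 36 * c - 6 + 2 * δ.re)) = 0 := by
      linarith
    rcases mul_eq_zero.mp h0 with h0 | h0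
    · exact hN h0
    · have : 3 * b ^ 2 + 2 * (36 * b ^ 2 * c + 3 * b * δ.im + 72 * c ^ 2 - 18 * c - 3 + δ.re) = 0 := by
        linarith
      omega
  · obtain ⟨δ, hδ⟩ := pow_one_add (R := ℤ√(-6)) ((4:ℤ) : ℤ√(-6)) ⟨144 * c ^ 2 - 36 * c - 6, b * (24 * c + 1)⟩ j
    rw [pow_succ, pow_mul, hω2, hδ, hω] at hZ
    rw [← hZ] at hZ2
    simp at hZ2
    have : (9 * b ^ 2 - 2) + 4 * (3 * b * (δ.re * (2 * b) + δ.im * (3 * b ^ 2 - 2)) + (δ.re * (3 * b ^ 2 - 2) - 6 * δ.im * (2 * b))) = 1 := by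
      linarith
    omega


theorem sq_mod3 (t : ℤ) : t ^ 2 % 3 = 0 ∨ t ^ 2 % 3 = 1 := by
  rcases (by omega : t % 3 = 0 ∨ t % 3 = 1 ∨ t % 3 = 2) with h | h | h <;> rw [int_pow_mod', h] <;> simp

theorem sq_mod5 (t : ℤ) : t ^ 2 % 5 = 0 ∨ t ^ 2 % 5 = 1 ∨ t ^ 2 % 5 = 4 := by
  rcases (by omega : t % 5 = 0 ∨ t % 5 = 1 ∨ t % 5 = 2 ∨ t % 5 = 3 ∨ t % 5 = 4) with h | h | h | h | h <;>
    rw [int_pow_mod', h] <;> simp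

theorem sq_mod7 (t : ℤ) : t ^ 2 % 7 = 0 ∨ t ^ 2 % 7 = 1 ∨ t ^ 2 % 7 = 2 ∨ t ^ 2 % 7 = 4 := by
  rcases (by omega : t % 7 = 0 ∨ t % 7 = 1 ∨ t % 7 = 2 ∨ t % 7 = 3 ∨ t % 7 = 4 ∨ t % 7 = 5 ∨ t % 7 = 6)
    with h | h | h | h | h | h | h <;>
    rw [int_pow_mod', h] <;> simp

theorem neg_three_lem (Q t : ℤ) (hQ : 0 < Q) (hodd : Q % 2 = 1) (h3 : Q % 3 = 2) (h : Q ∣ t ^ 2 + 3) : False := by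
  lift Q to ℕ using hQ.le
  have hJ : jacobiSym (-3) Q = -1 := by
    rw [jacobiSym.mod_right (-3) (Nat.odd_iff.mpr (by omega))]
    rcases (by omega : Q % 12 = 5 ∨ Q % 12 = 11) with h | h
    · rw [show 4 * (-3:ℤ).natAbs = 12 by rfl, h]; norm_num
    · rw [show 4 * (-3:ℤ).natAbs = 12 by rfl, h]; norm_num
  apply ZMod.nonsquare_of_jacobiSym_eq_neg_one hJ
  refine ⟨(t : ZMod Q), ?_⟩
  have := (ZMod.intCast_zmod_eq_zero_iff_dvd (t ^ 2 + 3) Q).mpr h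
  push_cast at this ⊢
  linear_combination -this

set_option maxHeartbeats 1000000 in
theorem red_list (A B C : ℤ) (hA : 0 < A) (hB1 : 2 * B ≤ A) (hB2 : -A ≤ 2 * B) (hAC : A ≤ C)
    (hdet : A * C - B ^ 2 = 105) : (A = 1 ∧ C = 105) ∨ (A = 2 ∧ C = 53) ∨ (A = 3 ∧ C = 35) ∨ (A = 5 ∧ C = 21) ∨ A = 6 ∨ (A = 7 ∧ C = 15) ∨ (A = 10 ∧ C = 13) ∨ (A = 11 ∧ C = 11) := by
  have hA2 : A ≤ 11 := by nlinarith
  have hBl : -5 ≤ B := by omega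
  have hBu : B ≤ 5 := by omega
  have : B ^ 2 = 0 ∨ B ^ 2 = 1 ∨ B ^ 2 = 4 ∨ B ^ 2 = 9 ∨ B ^ 2 = 16 ∨ B ^ 2 = 25 := by
    clear hdet
    interval_cases B <;> simp
  have h1 : 4 * B ^ 2 ≤ A ^ 2 := by nlinarith
  clear hB1 hB2 hBl hBu
  generalize B ^ 2 = b at *
  rcases this with rfl | rfl | rfl | rfl | rfl | rfl <;> interval_cases A <;> first | omega | (exfalso; omega)

theorem reduced6 (A B C r s y : ℤ) (hA : 0 < A) (hB1 : 2 * B ≤ A) (hB2 : -A ≤ 2 * B) (hAC : A ≤ C)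
    (hdet : A * C - B ^ 2 = 105) (hrs : y = A * s ^ 2 - 2 * B * s * r + C * r ^ 2)
    (hy3 : y % 3 = 1) (hy5 : y % 5 = 1 ∨ y % 5 = 4) (hy7 : y % 7 = 3 ∨ y % 7 = 5 ∨ y % 7 = 6) : A = 6 := by
  have hl := red_list A B C hA hB1 hB2 hAC hdet
  have h1 : A * y = (A * s - B * r) ^ 2 + 105 * r ^ 2 := by rw [hrs, ← hdet]; ring
  have h2 : C * y = (C * r - B * s) ^ 2 + 105 * s ^ 2 := by rw [hrs, ← hdet]; ring
  have a3 := sq_mod3 (A * s - B * r)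
  have a5 := sq_mod5 (A * s - B * r)
  have a7 := sq_mod7 (A * s - B * r)
  have c3 := sq_mod3 (C * r - B * s)
  have c5 := sq_mod5 (C * r - B * s)
  generalize (A * s - B * r) ^ 2 = u at *
  generalize (C * r - B * s) ^ 2 = v at *
  generalize r ^ 2 = r2 at *
  generalize s ^ 2 = s2 at *
  clear hrs hdet
  rcases hl with ⟨rfl, rfl⟩ | ⟨rfl, rfl⟩ | ⟨rfl, rfl⟩ | ⟨rfl, rfl⟩ | h | ⟨rfl, rfl⟩ | ⟨rfl, rfl⟩ | ⟨rfl, rfl⟩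
  · clear a3 a5 c3 c5 h2 hy5 hy3; omega
  · clear a5 a7 c3 c5 h2 hy5 hy7; omega
  · clear a3 a5 a7 c5 h1 hy5 hy7; omega
  · clear a5 a7 c3 c5 h2 hy5 hy7; omega
  · exact h
  · clear a3 a7 c3 c5 h2 hy3 hy7; omega
  · clear a3 a5 a7 c3 h1 hy3 hy7; omega
  · clear a5 a7 c3 c5 h2 hy5 hy7; omega


theorem case6_pre (X y : ℤ) (k : ℕ) (hk : 1 ≤ k) (h : 3 * X ^ 2 + 35 = 2 * y ^ (2 * k + 1)) :
    0 < y ∧ y % 4 = 3 ∧ y % 3 = 1 ∧ (y % 5 = 1 ∨ y % 5 = 4) ∧ (y % 7 = 3 ∨ y % 7 = 5 ∨ y % 7 = 6) := by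
  have hpos : 0 < y := by
    have : 0 < y ^ (2 * k + 1) := by nlinarith
    exact (Odd.pow_pos_iff ⟨k, rfl⟩).mp this
  have hdd : y ^ 2 ∣ y ^ (2 * k + 1) := pow_dvd_pow y (by omega)
  have hq : y ^ (2 * k + 1) = (y ^ k) ^ 2 * y := by rw [pow_succ y, mul_comm 2 k, pow_mul]
  have p5 : Prime (5:ℤ) := Int.prime_iff_natAbs_prime.mpr (by norm_num)
  have q5 := sq_mod5 (y ^ k)
  have q7 := sq_mod7 (y ^ k)
  have q3 := sq_mod3 (y ^ k)
  have x5 := sq_mod5 X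
  have x7 := sq_mod7 X
  refine ⟨hpos, ?_, ?_, ?_, ?_⟩
  · have hXo : X % 2 = 1 := by
      rcases Int.even_or_odd' X with ⟨c, rfl | rfl⟩
      · ring_nf at h; omega
      · omega
    obtain ⟨c, hc⟩ := Int.eight_dvd_sq_sub_one_of_odd (Int.odd_iff.mpr hXo)
    have h1 : y ^ (2 * k + 1) % 4 = 3 := by omega
    rcases (by omega : y % 4 = 0 ∨ y % 4 = 1 ∨ y % 4 = 2 ∨ y % 4 = 3) with h2 | h2 | h2 | h2
    · rw [int_pow_mod', h2] at h1; simp at h1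
    · rw [int_pow_mod', h2] at h1; simp at h1
    · rw [int_pow_mod', h2, pow_succ, pow_mul] at h1; omega
    · exact h2
  · have h1 : y ^ (2 * k + 1) % 3 = 1 := by omega
    rw [hq, Int.mul_emod] at h1
    rcases (by omega : y % 3 = 0 ∨ y % 3 = 1 ∨ y % 3 = 2) with h2 | h2 | h2 <;> rw [h2] at h1 ⊢ <;> rcases q3 with q3 | q3 <;> rw [q3] at h1 <;> omega
  · by_cases h0 : y % 5 = 0
    · exfalso
      obtain ⟨t, rfl⟩ : (5:ℤ) ∣ y := by omega
      have h25 : (25:ℤ) ∣ (5 * t) ^ (2 * k + 1) := dvd_trans ⟨t ^ 2, by ring⟩ hdd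
      have : (5:ℤ) ∣ X := by
        apply p5.dvd_of_dvd_pow (n := 2); omega
      obtain ⟨u, rfl⟩ := this
      ring_nf at h h25
      omega
    have h1 : y ^ (2 * k + 1) % 5 = (y ^ k) ^ 2 % 5 * (y % 5) % 5 := by rw [hq, Int.mul_emod]
    have hz : (y ^ k) ^ 2 % 5 ≠ 0 := by
      intro hz
      apply h0
      have : (5:ℤ) ∣ y := p5.dvd_of_dvd_pow (p5.dvd_of_dvd_pow (Int.dvd_of_emod_eq_zero hz))
      omega
    rcases (by omega : y % 5 = 1 ∨ y % 5 = 2 ∨ y % 5 = 3 ∨ y % 5 = 4) with h2 | h2 | h2 | h2 <;> rw [h2] at h1 ⊢ <;> rcases q5 with q5 | q5 | q5 <;> rw [q5] at h1 <;> norm_num at h1 ⊢ <;> omega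
  · by_cases h0 : y % 7 = 0
    · exfalso
      obtain ⟨t, rfl⟩ : (7:ℤ) ∣ y := by omega
      have h25 : (49:ℤ) ∣ (7 * t) ^ (2 * k + 1) := dvd_trans ⟨t ^ 2, by ring⟩ hdd
      have : (7:ℤ) ∣ X := by
        apply Prime.dvd_of_dvd_pow (n := 2) (Int.prime_iff_natAbs_prime.mpr (by norm_num)); omega
      obtain ⟨u, rfl⟩ := this
      ring_nf at h h25
      omega
    have h1 : y ^ (2 * k + 1) % 7 = (y ^ k) ^ 2 % 7 * (y % 7) % 7 := by rw [hq, Int.mul_emod]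
    have hz : (y ^ k) ^ 2 % 7 ≠ 0 := by
      intro hz
      apply h0
      have p7 : Prime (7:ℤ) := Int.prime_iff_natAbs_prime.mpr (by norm_num)
      have : (7:ℤ) ∣ y := p7.dvd_of_dvd_pow (p7.dvd_of_dvd_pow (Int.dvd_of_emod_eq_zero hz))
      omega
    rcases (by omega : y % 7 = 1 ∨ y % 7 = 2 ∨ y % 7 = 3 ∨ y % 7 = 4 ∨ y % 7 = 5 ∨ y % 7 = 6) with h2 | h2 | h2 | h2 | h2 | h2 <;> rw [h2] at h1 ⊢ <;> rcases q7 with q7 | q7 | q7 | q7 <;> rw [q7] at h1 <;> norm_num at h1 ⊢ <;> omega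

theorem case6_core (b c y : ℤ) (k : ℕ) (hk : 1 ≤ k) (hy : 0 < y) (hy4 : y % 4 = 3) (hc : b ^ 2 = 8 * c + 1)
  (hyb : y = 12 * c + 19) (hy3 : y % 3 = 1) (hZ1 : ((⟨3 * b, 1⟩ : ℤ√(-105)) * ⟨y - 35, b⟩ ^ k).im = 1 ∨ ((⟨3 * b, 1⟩ : ℤ√(-105)) * ⟨y - 35, b⟩ ^ k).im = -1) : False := by
  have hω3 : ∀ j, ((⟨y - 35, b⟩ : ℤ√(-105)) ^ j).re % 3 = if j % 2 = 0 then 1 else 2 := by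
    intro j
    induction j with
    | zero => simp
    | succ j ih =>
      rw [pow_succ, Zsqrtd.re_mul]
      simp only []
      generalize ((⟨y - 35, b⟩ : ℤ√(-105)) ^ j).im = q at *
      generalize ((⟨y - 35, b⟩ : ℤ√(-105)) ^ j).re = p at *
      have : p * (y - 35) + -105 * q * b = -p + 3 * (p * (4 * c - 5) - 35 * q * b) := by rw [hyb]; ring
      rw [this]
      split_ifs at ih ⊢ <;> omega
  have hc0 : 0 ≤ c := by nlinarith [sq_nonneg b]
  have h3 := hω3 k
  have hβ : ∀ u : ℤ√(-105), ((⟨3 * b, 1⟩ : ℤ√(-105)) * u).im = 3 * (b * u.im) + u.re := by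
    intro u; rw [Zsqrtd.im_mul]; ring
  rw [hβ] at hZ1
  have hωv : (⟨y - 35, b⟩ : ℤ√(-105)) = ⟨12 * c - 16, b⟩ := by rw [hyb]; ext <;> simp; ring
  rw [hωv] at hZ1 h3
  clear hω3 hωv
  set ω : ℤ√(-105) := ⟨12 * c - 16, b⟩ with hω
  have hω2 : ω ^ 2 = -1 + ((8:ℤ) : ℤ√(-105)) * ⟨18 * c ^ 2 - 153 * c + 19, (3 * c - 4) * b⟩ := by
    rw [pow_two]
    ext
    · simp [hω]; linear_combination (-105) * hc
    · simp [hω]; ring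
  set δ : ℤ√(-105) := ⟨18 * c ^ 2 - 153 * c + 19, (3 * c - 4) * b⟩ with hδ
  have hω4 : ω ^ 4 = 1 + ((16:ℤ) : ℤ√(-105)) * (-δ + 4 * δ ^ 2) := by
    rw [show 4 = 2 * 2 by rfl, pow_mul, hω2]; push_cast; ring
  obtain ⟨j, hj⟩ : ∃ j, k = 4 * j ∨ k = 4 * j + 1 ∨ k = 4 * j + 2 ∨ k = 4 * j + 3 := ⟨k / 4, by omega⟩
  rcases hj with rfl | rfl | rfl | rfl
  · have hZ : 3 * (b * (ω ^ (4 * j)).im) + (ω ^ (4 * j)).re = 1 := by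
      rw [if_pos (by omega)] at h3; omega
    obtain ⟨N, hN, ε, hε⟩ := pow_parity (R := ℤ√(-105)) 16 (-δ + 4 * δ ^ 2) (by norm_num) (by norm_num) j (by omega)
    rw [pow_mul, hω4, hε] at hZ
    obtain ⟨φ, hφ⟩ : ∃ φ : ℤ√(-105), -δ + 4 * δ ^ 2 + 2 * ε = δ + 2 * φ := ⟨-δ + 2 * δ ^ 2 + ε, by ring⟩
    rw [hφ] at hZ
    simp [hδ] at hZ
    have h0 : N * (3 * b * ((3 * c - 4) * b + 2 * φ.im) + (18 * c ^ 2 - 153 * c + 19 + 2 * φ.re)) = 0 := by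
      linarith
    rcases mul_eq_zero.mp h0 with h0 | h0
    · exact hN h0
    · have h5 : 3 * (3 * c - 4) * (8 * c + 1) + (18 * c ^ 2 - 153 * c + 19) + 2 * (3 * b * φ.im + φ.re) = 0 := by
        rw [← hc]; linarith
      ring_nf at h5
      omega
  · have hZ : 3 * (b * (ω ^ (4 * j + 1)).im) + (ω ^ (4 * j + 1)).re = -1 := by
      rw [if_neg (by omega)] at h3; omega
    have hc4 : c % 4 = 3 := by
      obtain ⟨ε, hε⟩ := pow_one_add (R := ℤ√(-105)) ((16:ℤ) : ℤ√(-105)) (-δ + 4 * δ ^ 2) j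
      have h5 : ω ^ (4 * j + 1) = ω + ((16:ℤ) : ℤ√(-105)) * (ω * ε) := by
        rw [pow_succ, pow_mul, hω4, hε]; ring
      rw [h5] at hZ
      generalize ω * ε = v at hZ
      simp [hω] at hZ
      have : 3 * (8 * c + 1) + (12 * c - 16) + 16 * (3 * (b * v.im) + v.re) = -1 := by
        rw [← hc]; linarith
      omega
    obtain ⟨κ, hκ⟩ : ∃ κ : ℤ, κ = -105 * b ^ 2 := ⟨_, rfl⟩
    have hQ : (((3 * c - 4 : ℤ)) : ℤ√(-105)) ∣ ω ^ (4 * j + 1) - ⟨0, b⟩ * ((κ ^ (2 * j) : ℤ) : ℤ√(-105)) := by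
      have h5 : ω ^ (4 * j + 1) = ω * (ω ^ 2) ^ (2 * j) := by rw [pow_succ, ← pow_mul]; ring_nf
      have e1 : (((3 * c - 4 : ℤ)) : ℤ√(-105)) ∣ ω - ⟨0, b⟩ := modz _ _ _ ⟨4, by simp [hω]; ring⟩ (by simp [hω])
      have e2 : (((3 * c - 4 : ℤ)) : ℤ√(-105)) ∣ ω ^ 2 - (κ : ℤ√(-105)) := by
        apply modz
        · exact ⟨16 * (3 * c - 4), by rw [pow_two ω, hκ]; simp only [hω, Zsqrtd.re_mul, Zsqrtd.im_mul, Zsqrtd.re_intCast, Zsqrtd.im_intCast]; ring⟩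
        · exact ⟨8 * b, by rw [pow_two ω, hκ]; simp only [hω, Zsqrtd.re_mul, Zsqrtd.im_mul, Zsqrtd.re_intCast, Zsqrtd.im_intCast]; ring⟩
      have e3 := dvd_trans e2 (sub_dvd_pow_sub_pow _ _ (2 * j))
      rw [h5]
      rw [Int.cast_pow]
      have := dvd_add (Dvd.dvd.mul_right e1 ((ω ^ 2) ^ (2 * j))) (Dvd.dvd.mul_left e3 ⟨0, b⟩)
      convert this using 1
      ring
    rw [Zsqrtd.intCast_dvd] at hQ
    obtain ⟨⟨p, hp⟩, ⟨q, hq⟩⟩ := hQ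
    rw [Zsqrtd.re_sub] at hp
    rw [Zsqrtd.im_sub] at hq
    rw [Zsqrtd.re_mul] at hp
    rw [Zsqrtd.im_mul] at hq
    simp only [Zsqrtd.re_intCast, Zsqrtd.im_intCast, mul_zero, zero_mul, add_zero, sub_zero, zero_add] at hp hq
    apply neg_three_lem (3 * c - 4) (3 * b * κ ^ j) (by omega) (by omega) (by omega)
    refine ⟨-3 * (3 * b * q + p), ?_⟩
    have e4 : (κ ^ j) ^ 2 = κ ^ (2 * j) := by rw [← pow_mul, mul_comm]
    rw [mul_pow, e4]
    linear_combination 3 * hZ - 3 * hp - 9 * b * hq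
  · have hZ : 3 * (b * (ω ^ (4 * j + 2)).im) + (ω ^ (4 * j + 2)).re = 1 := by
      rw [if_pos (by omega)] at h3; omega
    obtain ⟨ε, hε⟩ := pow_one_add (R := ℤ√(-105)) ((16:ℤ) : ℤ√(-105)) (-δ + 4 * δ ^ 2) j
    obtain ⟨v, hv⟩ : ∃ v, ω ^ (4 * j + 2) = -1 + ((8:ℤ) : ℤ√(-105)) * v := by
      refine ⟨δ + 2 * ω ^ 2 * ε, ?_⟩
      rw [pow_add, pow_mul, hω4, hε]
      linear_combination (norm := skip) hω2
      push_cast; ring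
    rw [hv] at hZ
    simp at hZ
    have : 8 * (3 * (b * v.im) + v.re) = 2 := by linarith
    omega
  · have hZ : 3 * (b * (ω ^ (4 * j + 3)).im) + (ω ^ (4 * j + 3)).re = -1 := by
      rw [if_neg (by omega)] at h3; omega
    obtain ⟨ε, hε⟩ := pow_one_add (R := ℤ√(-105)) ((16:ℤ) : ℤ√(-105)) (-δ + 4 * δ ^ 2) j
    obtain ⟨v, hv⟩ : ∃ v, ω ^ (4 * j + 3) = -ω + ((8:ℤ) : ℤ√(-105)) * v := by
      refine ⟨ω * (δ + 2 * ω ^ 2 * ε), ?_⟩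
      rw [pow_add, pow_mul, hω4, hε]
      linear_combination (norm := skip) ω * hω2
      push_cast; ring
    rw [hv] at hZ
    simp [hω] at hZ
    have : - 3 * (8 * c + 1) - (12 * c - 16) + 8 * (3 * (b * v.im) + v.re) = -1 := by
      rw [← hc]; linarith
    omega

theorem case6 (X y : ℤ) (k : ℕ) (hk : 1 ≤ k) (h : 3 * X ^ 2 + 35 = 2 * y ^ (2 * k + 1)) : False := by
  obtain ⟨hpos, hy4, hy3, hy5, hy7⟩ := case6_pre X y k hk h
  have hT : (3 * X) ^ 2 - (-105) = 6 * y ^ (2 * k + 1) := by linarith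
  obtain ⟨A, B, C', hA, hB1, hB2, hAC, hdet, ⟨r, s, hrs⟩, ⟨e, f, hef, hdv⟩, -⟩ :=
    form_exists 105 (3 * X) (6 * y ^ (2 * k)) y (by norm_num) hpos (by rw [pow_succ y] at hT; linarith)
  obtain rfl := reduced6 A B C' r s y hA hB1 hB2 hAC hdet hrs hy3 hy5 hy7
  obtain ⟨g, h', hgh, H⟩ := gen_div (-105) (3 * X) 6 y e f (2 * k + 1) hpos.ne' hT (by linarith) hdv
  obtain ⟨h0, hg⟩ := desc6 (k + 1) g h' (by
    rw [show (36:ℤ) = 6 ^ 2 by norm_num, ← pow_mul, show 2 * (k + 1) = 2 * k + 1 + 1 by ring, ← hgh]; ring)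
  obtain ⟨a, rfl⟩ : (3:ℤ) ∣ e := by
    apply Int.prime_three.dvd_of_dvd_pow (n := 2)
    exact ⟨2 * y - 35 * f ^ 2, by linarith⟩
  have H2 := cancel_lem (-105) 6 (3 * X) k ⟨3 * a, f⟩ ⟨y - 35 * f ^ 2, a * f⟩ (by norm_num) (by
    rw [pow_two]
    ext
    · simp; linarith
    · simp; ring) g h' h0 hg H
  have hf := norm_f _ _ _ _ _ _ _ H2
  have hf2 : f ^ 2 = 1 := by rcases hf with rfl | rfl <;> norm_num
  have hya : 2 * y = 3 * a ^ 2 + 35 := by rw [hf2] at hef; linarith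
  obtain ⟨b, hba, hb⟩ : ∃ b : ℤ, b ^ 2 = a ^ 2 ∧ ∃ Z : ℤ√(-105), ((⟨3 * b, 1⟩ : ℤ√(-105)) * ⟨y - 35, b⟩ ^ k) = Z ∧
      (Z.im = 1 ∨ Z.im = -1) := by
    rcases hf with rfl | rfl
    · refine ⟨a, rfl, _, rfl, ?_⟩
      simp only [one_pow, mul_one] at H2
      rcases H2 with H2 | H2 <;> rw [H2] <;> simp
    · refine ⟨-a, by ring, _, rfl, ?_⟩
      have e1 : (⟨3 * -a, 1⟩ : ℤ√(-105)) = -⟨3 * a, -1⟩ := by ext <;> simp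
      have e2 : (⟨y - 35, -a⟩ : ℤ√(-105)) = ⟨y - 35 * (-1) ^ 2, a * -1⟩ := by ext <;> simp
      rw [e1, e2, neg_mul]
      rcases H2 with H2 | H2 <;> rw [H2] <;> simp
  rw [← hba] at hya
  obtain ⟨Z, hZ, hZ1⟩ := hb
  have hbo : b % 2 = 1 := by
    rcases Int.even_or_odd' b with ⟨c, rfl | rfl⟩ <;> ring_nf at hya <;> omega
  obtain ⟨c, hc⟩ := Int.eight_dvd_sq_sub_one_of_odd (Int.odd_iff.mpr hbo)
  rw [← hZ] at hZ1
  exact case6_core b c y k hk hpos hy4 (by linarith) (by linarith) hy3 hZ1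


theorem binom2 {R : Type*} [CommRing R] (x : R) (n : ℕ) : ∃ s, (1 + x) ^ n = 1 + n * x + x ^ 2 * s := by
  induction n with
  | zero => exact ⟨0, by simp⟩
  | succ n ih =>
    obtain ⟨s, h⟩ := ih
    exact ⟨s + n + x * s, by rw [pow_succ, h]; push_cast; ring⟩

abbrev GI := ℤ√(-1)

theorem gi_unit (u : GI) (h : IsUnit u) : u ^ 4 = 1 := by
  have h1 : u.norm = 1 := (Zsqrtd.norm_eq_one_iff' (by norm_num) u).mpr h
  rw [Zsqrtd.norm_def] at h1
  have h2 : u.re ^ 2 + u.im ^ 2 = 1 := by linarith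
  have h4 : u.re * u.im = 0 := by
    have : u.re ^ 2 ≤ 1 := by nlinarith [sq_nonneg u.im]
    have : u.im ^ 2 ≤ 1 := by nlinarith [sq_nonneg u.re]
    have h5 : u.re ≤ 1 := by nlinarith
    have h6 : -1 ≤ u.re := by nlinarith
    have h7 : u.im ≤ 1 := by nlinarith
    have h8 : -1 ≤ u.im := by nlinarith
    obtain ⟨re, im⟩ := u
    simp only at *
    interval_cases re <;> interval_cases im <;> simp at *
  rw [show 4 = 2 * 2 by rfl, pow_mul]
  have : u ^ 2 = ⟨u.re ^ 2 - u.im ^ 2, 0⟩ := by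
    rw [pow_two]; ext
    · rw [Zsqrtd.re_mul]; simp only; ring
    · rw [Zsqrtd.im_mul]; simp only; linarith
  rw [this, pow_two]
  ext
  · rw [Zsqrtd.re_mul]; simp
    linear_combination (u.re ^ 2 + u.im ^ 2 + 1) * h2 - 4 * u.re * u.im * h4
  · rw [Zsqrtd.im_mul]; simp

theorem gauss_lem (X y : ℤ) (n : ℕ) (hn : 1 ≤ n) (h : X ^ 2 + 1 = 2 * y ^ n) :
    ∃ u β : GI, IsUnit u ∧ (⟨X, 1⟩ : GI) = ⟨1, 1⟩ * u * β ^ n ∧ β.norm ^ n = y ^ n := by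
  obtain ⟨m, rfl⟩ : ∃ m, X = 2 * m + 1 := by
    rcases Int.even_or_odd' X with ⟨m, rfl | rfl⟩
    · ring_nf at h; omega
    · exact ⟨m, rfl⟩
  have hN : (m + 1) ^ 2 + m ^ 2 = y ^ n := by linarith
  have hmul : (⟨m + 1, -m⟩ : GI) * ⟨m + 1, m⟩ = (y : GI) ^ n := by
    rw [← Int.cast_pow, ← hN]
    ext
    · rw [Zsqrtd.re_mul, Zsqrtd.re_intCast]; simp only []; ring
    · rw [Zsqrtd.im_mul, Zsqrtd.im_intCast]; simp only []; ring
  have hcop : IsCoprime (⟨m + 1, -m⟩ : GI) ⟨m + 1, m⟩ := by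
    refine ⟨⟨m + 1, m⟩ - (m * (m + 1) : ℤ) * ⟨1, -1⟩, - (m * (m + 1) : ℤ) * ⟨1, 1⟩, ?_⟩
    ext
    · simp; ring
    · simp; ring
  obtain ⟨β, hβ⟩ := exists_associated_pow_of_mul_eq_pow' hcop hmul
  obtain ⟨u, hu⟩ := hβ
  refine ⟨u, β, u.isUnit, ?_, ?_⟩
  · rw [mul_assoc, mul_comm (u : GI), hu]
    ext
    · simp; ring
    · simp
  · have h1 : (u : GI).norm = 1 := (Zsqrtd.norm_eq_one_iff' (by norm_num) _).mpr u.isUnit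
    have h2 := congrArg Zsqrtd.norm hu
    rw [Zsqrtd.norm_mul, h1, mul_one] at h2
    have h3 : (β ^ n).norm = β.norm ^ n := map_pow (Zsqrtd.normMonoidHom) β n
    rw [← h3, h2, ← hN, Zsqrtd.norm_def]; simp; ring

theorem stormer_core (b : ℤ) (k : ℕ) (hk : 1 ≤ k) (hb : 2 ∣ b)
    (H : ((⟨1, 1⟩ : GI) * ⟨0, 1⟩ ^ k * ⟨1 - b, b⟩ ^ (2 * k + 1)).im = 1 ∨ ((⟨1, 1⟩ : GI) * ⟨0, 1⟩ ^ k * ⟨1 - b, b⟩ ^ (2 * k + 1)).im = -1) : b = 0 := by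
  by_contra hb0
  have hi2 : (⟨0, 1⟩ : GI) ^ 2 = -1 := by rw [pow_two]; ext <;> simp
  have hz : (⟨1 - b, b⟩ : GI) = 1 + (b : GI) * ⟨-1, 1⟩ := by ext <;> simp; ring
  obtain ⟨c, rfl⟩ := hb
  have hg2 : (⟨-1, 1⟩ : GI) ^ 2 = ⟨0, -2⟩ := by rw [pow_two]; ext <;> simp
  obtain ⟨s, hs⟩ := binom2 (((2 * c : ℤ) : GI) * ⟨-1, 1⟩) (2 * k + 1)
  rw [← hz, mul_pow, hg2] at hs
  rcases Nat.even_or_odd' k with ⟨j, rfl | rfl⟩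
  · -- k even
    have hpm : (⟨0, 1⟩ : GI) ^ (2 * j) = 1 ∨ (⟨0, 1⟩ : GI) ^ (2 * j) = -1 := by
      rw [pow_mul, hi2]; exact neg_one_pow_eq_or _ _
    have H1 : ((⟨1 - 2 * c, 2 * c⟩ : GI) ^ (2 * (2 * j) + 1)).re + ((⟨1 - 2 * c, 2 * c⟩ : GI) ^ (2 * (2 * j) + 1)).im = 1 := by
      have : ((⟨1 - 2 * c, 2 * c⟩ : GI) ^ (2 * (2 * j) + 1)).re + ((⟨1 - 2 * c, 2 * c⟩ : GI) ^ (2 * (2 * j) + 1)).im = 1 ∨ ((⟨1 - 2 * c, 2 * c⟩ : GI) ^ (2 * (2 * j) + 1)).re + ((⟨1 - 2 * c, 2 * c⟩ : GI) ^ (2 * (2 * j) + 1)).im = -1 := by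
        rcases hpm with h | h <;> rw [h] at H <;> simp at H <;> omega
      rcases this with h | h
      · exact h
      · exfalso
        rw [hs] at h
        simp [pow_two] at h
        ring_nf at h
        omega
    obtain ⟨e, t, ht, hj⟩ : ∃ e t : ℕ, t % 2 = 1 ∧ 2 * j = 2 ^ e * t := by
      obtain ⟨e, t, ht, h⟩ := Nat.exists_eq_two_pow_mul_odd (n := 2 * j) (by omega)
      exact ⟨e, t, Nat.odd_iff.mp ht, h⟩
    have key : ∀ e : ℕ, ∃ s : GI, (⟨1 - 2 * c, 2 * c⟩ : GI) ^ (2 * (2 ^ e * t)) =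
        1 + ((4 * c * 2 ^ e : ℤ) : GI) * (t * ⟨-1, 1⟩ + (2 * c : ℤ) * (⟨0, 1⟩ + 2 * s)) := by
      intro e
      induction e with
      | zero =>
        obtain ⟨s, hs⟩ := binom2 (((4 * c : ℤ) : GI) * (⟨-1, 1⟩ - (2 * c : ℤ) * ⟨0, 1⟩)) t
        obtain ⟨r, hr⟩ : ∃ r, t = 2 * r + 1 := ⟨t / 2, by omega⟩
        refine ⟨-(r + 1 : ℕ) * ⟨0, 1⟩ + (⟨-1, 1⟩ - (2 * c : ℤ) * ⟨0, 1⟩) ^ 2 * s, ?_⟩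
        have h2 : (⟨1 - 2 * c, 2 * c⟩ : GI) ^ 2 = 1 + ((4 * c : ℤ) : GI) * (⟨-1, 1⟩ - (2 * c : ℤ) * ⟨0, 1⟩) := by
          rw [pow_two]; ext <;> simp <;> ring
        rw [pow_zero, one_mul, pow_mul, h2, hs, hr]
        push_cast
        ring
      | succ e ih =>
        obtain ⟨s, hs⟩ := ih
        rw [show 2 * (2 ^ (e + 1) * t) = 2 * (2 ^ e * t) * 2 by ring, pow_mul, hs]
        refine ⟨s + 2 ^ e * (t ^ 2 * ⟨0, -1⟩ + t * ⟨-1, 1⟩ * (2 * c : ℤ) * (⟨0, 1⟩ + 2 * s) + 2 * (c : GI) ^ 2 * (⟨0, 1⟩ + 2 * s) ^ 2), ?_⟩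
        have h0 : (⟨0, -2⟩ : GI) = 2 * ⟨0, -1⟩ := by ext <;> simp
        rw [h0] at hg2
        push_cast
        linear_combination (16 * (c : GI) ^ 2 * (2 ^ e) ^ 2 * t ^ 2) * hg2
    obtain ⟨s, hs⟩ := key e
    rw [← hj] at hs
    have hN : (4 * c * 2 ^ e : ℤ) ≠ 0 := by
      have : c ≠ 0 := by rintro rfl; simp at hb0
      positivity
    rw [pow_succ, hs] at H1
    generalize (4 * c * 2 ^ e : ℤ) = N at *
    obtain ⟨p, q⟩ := s
    simp at H1
    have h0 : N * (2 * c) * (- 2 * t + (1 - 4 * c) + 2 * (p * (1 - 2 * c) - q * 2 * c + p * 2 * c + q * (1 - 2 * c))) = 0 := by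
      linear_combination H1
    have hc : c ≠ 0 := by rintro rfl; simp at hb0
    have := (mul_eq_zero.mp h0).resolve_left (mul_ne_zero hN (by omega))
    ring_nf at this
    omega
  · have hpm : (⟨0, 1⟩ : GI) ^ (2 * j + 1) = ⟨0, 1⟩ ∨ (⟨0, 1⟩ : GI) ^ (2 * j + 1) = -⟨0, 1⟩ := by
      rw [pow_succ, pow_mul, hi2]
      rcases neg_one_pow_eq_or GI j with h | h <;> rw [h] <;> simp
    have H1 : ((⟨1 - 2 * c, 2 * c⟩ : GI) ^ (2 * (2 * j + 1) + 1)).re - ((⟨1 - 2 * c, 2 * c⟩ : GI) ^ (2 * (2 * j + 1) + 1)).im = 1 ∨ ((⟨1 - 2 * c, 2 * c⟩ : GI) ^ (2 * (2 * j + 1) + 1)).re - ((⟨1 - 2 * c, 2 * c⟩ : GI) ^ (2 * (2 * j + 1) + 1)).im = -1 := by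
      rcases hpm with h | h <;> rw [h] at H <;> simp at H <;> omega
    rw [hs] at H1
    obtain ⟨p, q⟩ := s
    simp [pow_two] at H1
    rcases H1 with H1 | H1
    · have hc : c ≠ 0 := by rintro rfl; simp at hb0
      have h0 : 4 * c * (-(4 * j + 3) + 2 * c * (p + q)) = 0 := by linear_combination H1
      have := (mul_eq_zero.mp h0).resolve_left (by omega)
      rw [mul_assoc] at this
      omega
    · ring_nf at H1
      omega

theorem stormer (X y : ℤ) (k : ℕ) (hk : 1 ≤ k) (h : X ^ 2 + 1 = 2 * y ^ (2 * k + 1)) : y = 1 := by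
  obtain ⟨u, β, hu, hX, hN⟩ := gauss_lem X y (2 * k + 1) (by omega) h
  have hi : IsUnit (⟨0, 1⟩ : GI) := IsUnit.of_mul_eq_one (⟨0, -1⟩ : GI) (by ext <;> simp)
  have hi4 := gi_unit _ hi
  have hi2 : (⟨0, 1⟩ : GI) ^ 2 = -1 := by rw [pow_two]; ext <;> simp
  -- choose the unit
  obtain ⟨z, hz, hzn⟩ : ∃ z : GI, (⟨X, 1⟩ : GI) = ⟨1, 1⟩ * ⟨0, 1⟩ ^ k * z ^ (2 * k + 1) ∧ z.norm ^ (2 * k + 1) = y ^ (2 * k + 1) := by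
    set v : GI := u * (⟨0, 1⟩ ^ 3) ^ k with hv
    have hvu : IsUnit v := hu.mul ((hi.pow 3).pow k)
    have hv4 := gi_unit _ hvu
    refine ⟨v ^ (2 * k + 1) * β, ?_, ?_⟩
    · have e1 : (v ^ (2 * k + 1) * β) ^ (2 * k + 1) = v * β ^ (2 * k + 1) := by
        rw [mul_pow, ← pow_mul, show (2 * k + 1) * (2 * k + 1) = 4 * (k * k + k) + 1 by ring, pow_succ, pow_mul, hv4]; simp
      have e2 : (⟨0, 1⟩ : GI) ^ k * (⟨0, 1⟩ ^ 3) ^ k = 1 := by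
        rw [← mul_pow, ← pow_succ', hi4, one_pow]
      rw [e1, hX, hv]
      linear_combination (-(⟨1, 1⟩ : GI) * u * β ^ (2 * k + 1)) * e2
    · have h1 : v.norm = 1 := (Zsqrtd.norm_eq_one_iff' (by norm_num) _).mpr hvu
      have h3 : (v ^ (2 * k + 1)).norm = v.norm ^ (2 * k + 1) := map_pow (Zsqrtd.normMonoidHom) v _
      rw [Zsqrtd.norm_mul, h3, h1, one_pow, one_mul, hN]
  obtain ⟨a, b⟩ := z
  have hab : a + b = 1 ∨ a + b = -1 := by
    apply norm_f (-1) X (a - b) (a + b) (-2 * a * b) (a - b) k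
    left
    have e1 : (⟨-2 * a * b, (a - b) * (a + b)⟩ : GI) = ⟨0, 1⟩ * ⟨a, b⟩ ^ 2 := by
      rw [pow_two]; ext <;> simp <;> ring
    have e2 : (⟨a - b, a + b⟩ : GI) = ⟨1, 1⟩ * ⟨a, b⟩ := by
      ext <;> simp <;> ring
    rw [hz, e1, e2, mul_pow, ← pow_mul, pow_succ]
    ring
  have hfin : a * b = 0 → y = 1 := by
    intro h0
    have h1 : (⟨a, b⟩ : GI).norm = 1 := by
      rw [Zsqrtd.norm_def]; simp only []
      rcases hab with h | h
      · linear_combination (a + b + 1) * h - 2 * h0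
      · linear_combination (a + b - 1) * h - 2 * h0
    rw [h1, one_pow] at hzn
    have hy : IsUnit y := (isUnit_pow_iff (by omega : 2 * k + 1 ≠ 0)).mp (by rw [← hzn]; exact isUnit_one)
    rcases Int.isUnit_iff.mp hy with rfl | rfl
    · rfl
    · exfalso; rw [Odd.neg_one_pow ⟨k, rfl⟩] at hzn; norm_num at hzn
  -- normalise a + b = 1
  obtain ⟨a', b', hab', habz, X', hX'⟩ : ∃ a' b' : ℤ, a' + b' = 1 ∧ (a' * b' = 0 → a * b = 0) ∧ ∃ X' : ℤ,
      ((⟨1, 1⟩ : GI) * ⟨0, 1⟩ ^ k * ⟨a', b'⟩ ^ (2 * k + 1) = ⟨X', 1⟩ ∨ (⟨1, 1⟩ : GI) * ⟨0, 1⟩ ^ k * ⟨a', b'⟩ ^ (2 * k + 1) = -⟨X', 1⟩) := by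
    rcases hab with h | h
    · exact ⟨a, b, h, id, X, Or.inl hz.symm⟩
    · refine ⟨-a, -b, by omega, by simp, X, Or.inr ?_⟩
      have : (⟨-a, -b⟩ : GI) = -⟨a, b⟩ := by ext <;> simp
      rw [this, Odd.neg_pow ⟨k, rfl⟩, hz]; ring
  apply hfin
  apply habz
  clear hfin habz hab hzn hz
  rcases Int.even_or_odd' b' with ⟨c, hc | hc⟩
  · have ha : a' = 1 - b' := by omega
    subst ha
    have := stormer_core b' k hk ⟨c, hc⟩ (by
      rcases hX' with h | h <;> rw [h] <;> simp)
    rw [this]; simp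
  · have hb : b' = 1 - a' := by omega
    subst hb
    have := stormer_core a' k hk (by omega) (by
      have e1 : (⟨1 - a', a'⟩ : GI) = ⟨0, 1⟩ * star (⟨a', 1 - a'⟩ : GI) := by ext <;> simp
      have e2 : (⟨1, 1⟩ : GI) = ⟨0, 1⟩ * star (⟨1, 1⟩ : GI) := by ext <;> simp
      have e3 : star (⟨0, 1⟩ : GI) = -⟨0, 1⟩ := by ext <;> simp
      have e4 : (⟨1, 1⟩ : GI) * ⟨0, 1⟩ ^ k * ⟨1 - a', a'⟩ ^ (2 * k + 1) = - star ((⟨1, 1⟩ : GI) * ⟨0, 1⟩ ^ k * ⟨a', 1 - a'⟩ ^ (2 * k + 1)) := by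
        rw [star_mul', star_mul', star_pow, star_pow, e3, e1, mul_pow]
        conv_lhs => rw [e2]
        rw [pow_succ (⟨0, 1⟩ : GI), pow_mul (⟨0, 1⟩ : GI), hi2, neg_pow (⟨0, 1⟩ : GI) k]
        linear_combination (star (⟨1, 1⟩ : GI) * ⟨0, 1⟩ ^ k * (-1) ^ k * star (⟨a', 1 - a'⟩ : GI) ^ (2 * k + 1)) * hi2
      rw [e4]
      rcases hX' with h | h <;> rw [h] <;> simp)
    rw [this]; simp


noncomputable def ca (m : ℕ) : ℝ := ∏ j ∈ Finset.range m, ((j : ℝ) + 3 / 4)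
noncomputable def cb (m : ℕ) : ℝ := ∏ j ∈ Finset.range m, ((j : ℝ) + 5 / 4)

theorem ca_pos (m : ℕ) : 0 < ca m := Finset.prod_pos fun j _ => by positivity
theorem cb_pos (m : ℕ) : 0 < cb m := Finset.prod_pos fun j _ => by positivity
theorem ca_succ (m : ℕ) : ca (m + 1) = ca m * (m + 3 / 4) := Finset.prod_range_succ _ _
theorem cb_succ (m : ℕ) : cb (m + 1) = cb m * (m + 5 / 4) := Finset.prod_range_succ _ _

noncomputable def cc (r k : ℕ) : ℝ :=
  ca r * cb r / (ca k * cb (r - k) * (k.factorial : ℝ) * ((r - k).factorial : ℝ))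

theorem cc_pos (r k : ℕ) : 0 < cc r k := by
  have := ca_pos r; have := cb_pos r; have := ca_pos k; have := cb_pos (r - k)
  unfold cc; positivity

theorem cc_A (r k : ℕ) (hk : k ≤ r) :
    cc (r + 1) k * (((r : ℝ) + 1 - k + 1 / 4) * (r + 1 - k)) = (((r : ℝ) + 1) ^ 2 - 1 / 16) * cc r k := by
  obtain ⟨m, rfl⟩ := Nat.exists_eq_add_of_le hk
  unfold cc
  rw [show k + m + 1 - k = m + 1 by omega, show k + m - k = m by omega, ca_succ, cb_succ, cb_succ, Nat.factorial_succ]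
  have := (ca_pos k).ne'; have := (cb_pos m).ne'
  have : (m.factorial : ℝ) ≠ 0 := by positivity
  have : (k.factorial : ℝ) ≠ 0 := by positivity
  have : (m : ℝ) + 5 / 4 ≠ 0 := by positivity
  have : (m : ℝ) + 1 ≠ 0 := by positivity
  push_cast
  field_simp
  ring

theorem cc_B (r k : ℕ) (hk : k ≤ r) :
    cc (r + 1) (k + 1) * (((k : ℝ) + 3 / 4) * (k + 1)) = (((r : ℝ) + 1) ^ 2 - 1 / 16) * cc r k := by
  unfold cc
  rw [show r + 1 - (k + 1) = r - k by omega, ca_succ, cb_succ, ca_succ, Nat.factorial_succ]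
  have := (ca_pos k).ne'; have := (cb_pos (r - k)).ne'
  have : ((r - k).factorial : ℝ) ≠ 0 := by positivity
  have : (k.factorial : ℝ) ≠ 0 := by positivity
  have : (k : ℝ) + 3 / 4 ≠ 0 := by positivity
  have : (k : ℝ) + 1 ≠ 0 := by positivity
  push_cast
  field_simp
  ring

noncomputable def Kf (r : ℕ) (t : ℝ) : ℝ :=
  ∑ k ∈ Finset.range (r + 1), cc r k * Real.sin ((1 / 4 + r - 2 * k) * t)

theorem Kf_deriv (r : ℕ) (t : ℝ) :
    HasDerivAt (Kf (r + 1)) (-(2 * ((((r : ℝ) + 1) ^ 2 - 1 / 16) / (r + 1)) * Real.sin t * Kf r t)) t := by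
  have h1 : HasDerivAt (Kf (r + 1)) (∑ k ∈ Finset.range (r + 1 + 1), cc (r + 1) k *
      (Real.cos ((1 / 4 + ((r + 1 : ℕ) : ℝ) - 2 * k) * t) * ((1 / 4 + ((r + 1 : ℕ) : ℝ) - 2 * k) * 1))) t := by
    unfold Kf
    apply HasDerivAt.fun_sum
    intro k _
    exact (((hasDerivAt_id t).const_mul _).sin).const_mul _
  convert h1 using 1
  have hR : ((r : ℝ) + 1) ≠ 0 := by positivity
  have e1 : ∀ k : ℕ, cc (r + 1) k *
      (Real.cos ((1 / 4 + ((r + 1 : ℕ) : ℝ) - 2 * k) * t) * ((1 / 4 + ((r + 1 : ℕ) : ℝ) - 2 * k) * 1)) =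
      1 / (r + 1) * (cc (r + 1) k * (((r : ℝ) + 1 - k + 1 / 4) * (r + 1 - k)) * Real.cos ((1 / 4 + ((r + 1 : ℕ) : ℝ) - 2 * k) * t)
       - cc (r + 1) k * (((k : ℝ) - 1 / 4) * k) * Real.cos ((1 / 4 + ((r + 1 : ℕ) : ℝ) - 2 * k) * t)) := by
    intro k
    push_cast
    field_simp
    ring
  rw [Finset.sum_congr rfl (fun k _ => e1 k), ← Finset.mul_sum, Finset.sum_sub_distrib, Finset.sum_range_succ,
    Finset.sum_range_succ' (n := r + 1)]
  have e2 : ∀ k ∈ Finset.range (r + 1), cc (r + 1) k * (((r : ℝ) + 1 - k + 1 / 4) * (r + 1 - k)) * Real.cos ((1 / 4 + ((r + 1 : ℕ) : ℝ) - 2 * k) * t)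
      = (((r : ℝ) + 1) ^ 2 - 1 / 16) * (cc r k * Real.cos ((1 / 4 + r - 2 * k) * t + t)) := by
    intro k hk
    rw [cc_A r k (by simpa [Nat.lt_succ_iff] using hk), mul_assoc]
    congr 3; push_cast; ring
  have e3 : ∀ k ∈ Finset.range (r + 1), cc (r + 1) (k + 1) * ((((k + 1 : ℕ) : ℝ) - 1 / 4) * ((k + 1 : ℕ) : ℝ)) * Real.cos ((1 / 4 + ((r + 1 : ℕ) : ℝ) - 2 * ((k + 1 : ℕ) : ℝ)) * t)
      = (((r : ℝ) + 1) ^ 2 - 1 / 16) * (cc r k * Real.cos ((1 / 4 + r - 2 * k) * t - t)) := by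
    intro k hk
    rw [← mul_assoc (((r : ℝ) + 1) ^ 2 - 1 / 16), ← cc_B r k (by simpa [Nat.lt_succ_iff] using hk)]
    push_cast
    congr 2 <;> ring
  rw [Finset.sum_congr rfl e2, Finset.sum_congr rfl e3, ← Finset.mul_sum, ← Finset.mul_sum]
  have e4 : ∑ k ∈ Finset.range (r + 1), cc r k * Real.cos ((1 / 4 + r - 2 * k) * t + t) -
      ∑ k ∈ Finset.range (r + 1), cc r k * Real.cos ((1 / 4 + r - 2 * k) * t - t) = - 2 * Real.sin t * Kf r t := by
    unfold Kf
    rw [← Finset.sum_sub_distrib, Finset.mul_sum]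
    apply Finset.sum_congr rfl
    intro k _
    rw [Real.cos_add, Real.cos_sub]; ring
  push_cast
  linear_combination (-((((r : ℝ) + 1) ^ 2 - 1 / 16) / (r + 1))) * e4


theorem nonneg_of_deriv (f f' : ℝ → ℝ) (T : ℝ) (hf : ∀ t, HasDerivAt f (f' t) t) (h0 : f 0 = 0)
    (hp : ∀ t, 0 ≤ t → t ≤ T → 0 ≤ f' t) (t : ℝ) (ht : 0 ≤ t) (htT : t ≤ T) : 0 ≤ f t := by
  have hmono : MonotoneOn f (Set.Icc 0 T) := by
    apply monotoneOn_of_deriv_nonneg (convex_Icc 0 T)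
    · exact fun x _ => (hf x).continuousAt.continuousWithinAt
    · exact fun x _ => (hf x).differentiableAt.differentiableWithinAt
    · intro x hx
      rw [interior_Icc] at hx
      rw [(hf x).deriv]
      exact hp x hx.1.le hx.2.le
  have := hmono (Set.left_mem_Icc.mpr (ht.trans htT)) ⟨ht, htT⟩ ht
  rwa [h0] at this

noncomputable def Kh (r : ℕ) (t : ℝ) : ℝ := (-1) ^ r * Kf r t

theorem Kh_zero (r : ℕ) : Kh r 0 = 0 := by simp [Kh, Kf]

theorem Kh_deriv (r : ℕ) (t : ℝ) :
    HasDerivAt (Kh (r + 1)) (2 * ((((r : ℝ) + 1) ^ 2 - 1 / 16) / (r + 1)) * Real.sin t * Kh r t) t := by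
  have := (Kf_deriv r t).const_mul ((-1) ^ (r + 1))
  refine HasDerivAt.congr_deriv this ?_
  unfold Kh; ring

theorem Kh_bounds (r : ℕ) : ∀ t : ℝ, 0 ≤ t → t ≤ 1 / 239 →
    119 * (1 - Real.cos t) * (4 / 5 * (1 - Real.cos t)) ^ r ≤ Kh r t ∧
    Kh r t ≤ 1 / 956 * (2 * (1 - Real.cos t)) ^ r := by
  induction r with
  | zero =>
    intro t h0 h1
    have e : Kh 0 t = Real.sin (t / 4) := by
      unfold Kh Kf cc ca cb; simp; congr 1; ring
    rw [e, pow_zero, pow_zero, mul_one, mul_one]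
    constructor
    · have h2 := Real.one_sub_sq_div_two_le_cos (x := t)
      rcases h0.eq_or_lt with rfl | hpos
      · simp
      have h3 := Real.sin_gt_sub_cube (x := t / 4) (by positivity)
      nlinarith [mul_nonneg h0 (sub_nonneg.mpr h1), mul_nonneg (mul_nonneg h0 h0) (sub_nonneg.mpr h1)]
    · have := Real.sin_le (x := t / 4) (by positivity)
      linarith
  | succ r ih =>
    intro t h0 h1
    have hR : (0 : ℝ) < (r : ℝ) + 1 := by positivity
    have hv : ∀ t : ℝ, HasDerivAt (fun t => 1 - Real.cos t) (Real.sin t) t := by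
      intro t; simpa using (Real.hasDerivAt_cos t).const_sub 1
    have hs : ∀ t : ℝ, 0 ≤ t → t ≤ 1 / 239 → 0 ≤ Real.sin t := fun t a b =>
      Real.sin_nonneg_of_nonneg_of_le_pi a (by linarith [Real.pi_gt_three])
    have hv0 : ∀ t : ℝ, 0 ≤ 1 - Real.cos t := fun t => by linarith [Real.cos_le_one t]
    have hq1 : (((r : ℝ) + 1) ^ 2 - 1 / 16) / (r + 1) ≤ r + 1 := by
      rw [div_le_iff₀ hR]; nlinarith
    have hq2 : 2 / 5 * ((r : ℝ) + 2) ≤ (((r : ℝ) + 1) ^ 2 - 1 / 16) / (r + 1) := by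
      rw [le_div_iff₀ hR]; nlinarith [(Nat.cast_nonneg r : (0:ℝ) ≤ r)]
    constructor
    · have := nonneg_of_deriv (fun t => Kh (r + 1) t - 119 * (4 / 5) ^ (r + 1) * (1 - Real.cos t) ^ (r + 2))
        _ (1 / 239) (fun t => (Kh_deriv r t).sub (((hv t).pow (r + 2)).const_mul (119 * (4 / 5) ^ (r + 1)))) (by
          simp [Kh_zero]) (by
          intro t h0 h1
          have h2 := (ih t h0 h1).1
          have h3 := hs t h0 h1
          have h4 := hv0 t
          generalize (((r : ℝ) + 1) ^ 2 - 1 / 16) / (r + 1) = q at *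
          have h5 : (2 / 5 * ((r : ℝ) + 2)) * (119 * (1 - Real.cos t) * (4 / 5 * (1 - Real.cos t)) ^ r) ≤ q * Kh r t :=
            mul_le_mul hq2 h2 (by positivity) (le_trans (by positivity) hq2)
          have h6 := mul_nonneg h3 (sub_nonneg.mpr h5)
          rw [show r + 2 - 1 = r + 1 by omega]
          push_cast
          rw [mul_pow] at h6
          have : 2 * (Real.sin t * (q * Kh r t - 2 / 5 * ((r : ℝ) + 2) * (119 * (1 - Real.cos t) * ((4 / 5) ^ r * (1 - Real.cos t) ^ r)))) = 2 * q * Real.sin t * Kh r t - 119 * (4 / 5) ^ (r + 1) * (((r : ℝ) + 2) * (1 - Real.cos t) ^ (r + 1) * Real.sin t) := by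
            ring
          linarith) t h0 h1
      have e : 119 * (1 - Real.cos t) * (4 / 5 * (1 - Real.cos t)) ^ (r + 1) = 119 * (4 / 5) ^ (r + 1) * (1 - Real.cos t) ^ (r + 2) := by
        rw [mul_pow]; ring
      rw [e]
      linarith
    · have := nonneg_of_deriv (fun t => 1 / 956 * 2 ^ (r + 1) * (1 - Real.cos t) ^ (r + 1) - Kh (r + 1) t)
        _ (1 / 239) (fun t => (((hv t).pow (r + 1)).const_mul (1 / 956 * 2 ^ (r + 1))).sub (Kh_deriv r t)) (by
          simp [Kh_zero]) (by
          intro t h0 h1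
          have h2 := (ih t h0 h1).2
          have h2' := (ih t h0 h1).1
          have h3 := hs t h0 h1
          have h4 := hv0 t
          generalize (((r : ℝ) + 1) ^ 2 - 1 / 16) / (r + 1) = q at *
          have h5 : q * Kh r t ≤ (r + 1) * (1 / 956 * (2 * (1 - Real.cos t)) ^ r) :=
            mul_le_mul hq1 h2 (le_trans (by positivity) h2') hR.le
          have h6 := mul_nonneg h3 (sub_nonneg.mpr h5)
          rw [show r + 1 - 1 = r by omega]
          push_cast
          rw [mul_pow] at h6
          have : 2 * (Real.sin t * ((r + 1) * (1 / 956 * (2 ^ r * (1 - Real.cos t) ^ r)) - q * Kh r t)) = 1 / 956 * 2 ^ (r + 1) * (((r : ℝ) + 1) * (1 - Real.cos t) ^ r * Real.sin t) - 2 * q * Real.sin t * Kh r t := by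
            ring
          linarith) t h0 h1
      have e : 1 / 956 * (2 * (1 - Real.cos t)) ^ (r + 1) = 1 / 956 * 2 ^ (r + 1) * (1 - Real.cos t) ^ (r + 1) := by
        rw [mul_pow]; ring
      rw [e]
      linarith

/-- the angle -/
noncomputable def tau : ℝ := Real.arctan (1 / 239)

theorem tau_pos : 0 < tau := by unfold tau; exact Real.arctan_pos.mpr (by norm_num)

theorem arctan_le_self' (x : ℝ) (hx : 0 ≤ x) : Real.arctan x ≤ x := by
  have h := Real.le_tan (x := Real.arctan x) (Real.arctan_nonneg.mpr hx) (Real.arctan_lt_pi_div_two x)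
  rwa [Real.tan_arctan] at h

theorem tau_le : tau ≤ 1 / 239 := arctan_le_self' _ (by norm_num)

theorem cos_tau_sq : Real.cos tau ^ 2 = 57121 / 57122 := by
  unfold tau; rw [Real.cos_sq_arctan]; norm_num

theorem cos_tau_pos : 0 < Real.cos tau := Real.cos_arctan_pos _

theorem v_le : 2 * (1 - Real.cos tau) ≤ 1 / 57121 := by
  have := cos_tau_sq; have := cos_tau_pos; nlinarith

theorem v_ge : 1 / 57122 ≤ 2 * (1 - Real.cos tau) := by
  have := cos_tau_sq; have := cos_tau_pos; nlinarith

theorem Kf_tau (r : ℕ) : 119 / 114244 * (1 / 142805) ^ r ≤ |Kf r tau| ∧ |Kf r tau| ≤ 1 / 956 * (1 / 57121) ^ r := by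
  obtain ⟨h1, h2⟩ := Kh_bounds r tau tau_pos.le tau_le
  have hv := v_ge
  have hv' := v_le
  have h3 : 119 / 114244 * (1 / 142805) ^ r ≤ Kh r tau := by
    refine le_trans ?_ h1
    gcongr
    all_goals linarith
  have h4 : Kh r tau ≤ 1 / 956 * (1 / 57121) ^ r := by
    refine le_trans h2 ?_
    gcongr
  have h5 : |Kf r tau| = Kh r tau := by
    have : 0 ≤ Kh r tau := le_trans (by positivity) h3
    rw [← abs_of_nonneg this]; unfold Kh; rw [abs_mul, abs_pow]; simp
  rw [h5]; exact ⟨h3, h4⟩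


theorem ca_le (k m : ℕ) : ca (k + m) * (k.factorial : ℝ) ≤ ((k + m).factorial : ℝ) * ca k := by
  induction m with
  | zero => simp [mul_comm]
  | succ m ih =>
    rw [← add_assoc, ca_succ, Nat.factorial_succ]
    have := ca_pos (k + m)
    have := ca_pos k
    push_cast at ih ⊢
    calc ca (k + m) * ((k : ℝ) + m + 3 / 4) * k.factorial = (k + m + 3 / 4) * (ca (k + m) * k.factorial) := by ring
      _ ≤ (k + m + 1) * (((k + m).factorial : ℝ) * ca k) := by gcongr; norm_num
      _ = _ := by ring

theorem cb_le (k m : ℕ) : cb (k + m) * ((k + 1).factorial : ℝ) ≤ ((k + m + 1).factorial : ℝ) * cb k := by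
  induction m with
  | zero => simp [mul_comm]
  | succ m ih =>
    rw [← add_assoc, cb_succ, Nat.factorial_succ (k + m + 1)]
    have := cb_pos (k + m)
    have := cb_pos k
    push_cast at ih ⊢
    calc cb (k + m) * ((k : ℝ) + m + 5 / 4) * (k + 1).factorial = (k + m + 5 / 4) * (cb (k + m) * (k + 1).factorial) := by ring
      _ ≤ (k + m + 1 + 1) * (((k + m + 1).factorial : ℝ) * cb k) := mul_le_mul (by linarith) ih (by positivity) (by positivity)
      _ = _ := by ring

theorem cc_le (r k : ℕ) (hk : k ≤ r) : cc r k ≤ (r.choose (r - k) * (r + 1).choose k : ℕ) := by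
  obtain ⟨m, rfl⟩ := Nat.exists_eq_add_of_le hk
  have h1 := ca_le k m
  have h2 := cb_le m k
  rw [add_comm m k] at h2
  have c1 := Nat.add_choose_mul_factorial_mul_factorial k m
  have c2 := Nat.add_choose_mul_factorial_mul_factorial (m + 1) k
  rw [show m + 1 + k = k + m + 1 by ring] at c2
  have s1 : (k + m).choose (k + m - k) = (k + m).choose m := by congr 1; omega
  rw [s1]
  unfold cc
  rw [show k + m - k = m by omega]
  have p1 := ca_pos k; have p2 := cb_pos m; have p3 := ca_pos (k + m); have p4 := cb_pos (k + m)
  have f1 : (0:ℝ) < k.factorial := by positivity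
  have f2 : (0:ℝ) < m.factorial := by positivity
  have f3 : (0:ℝ) < (m + 1).factorial := by positivity
  rw [div_le_iff₀ (by positivity)]
  rw [← c1] at h1
  rw [← c2] at h2
  push_cast at h1 h2 ⊢
  have h1' : ca (k + m) ≤ (k + m).choose m * m.factorial * ca k := by
    apply le_of_mul_le_mul_right _ f1
    linarith
  have h2' : cb (k + m) ≤ (k + m + 1).choose k * k.factorial * cb m := by
    apply le_of_mul_le_mul_right _ f3
    linarith
  calc ca (k + m) * cb (k + m) ≤ ((k + m).choose m * m.factorial * ca k) * ((k + m + 1).choose k * k.factorial * cb m) :=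
        mul_le_mul h1' h2' p4.le (by positivity)
    _ = _ := by ring

theorem cc_sum (r : ℕ) : ∑ k ∈ Finset.range (r + 1), cc r k ≤ 4 ^ r := by
  calc ∑ k ∈ Finset.range (r + 1), cc r k ≤ ∑ k ∈ Finset.range (r + 1), ((r.choose (r - k) * (r + 1).choose k : ℕ) : ℝ) :=
        Finset.sum_le_sum fun k hk => cc_le r k (by simpa [Nat.lt_succ_iff] using hk)
    _ = (((r + 1 + r).choose r : ℕ) : ℝ) := by
        rw [← Nat.cast_sum, Nat.add_choose_eq, Finset.Nat.sum_antidiagonal_eq_sum_range_succ (fun i j => (r + 1).choose i * r.choose j)]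
        congr 1
        exact Finset.sum_congr rfl fun k _ => mul_comm _ _
    _ ≤ 4 ^ r := by
        have := Nat.choose_middle_le_pow r
        rw [show r + 1 + r = 2 * r + 1 by ring]
        exact_mod_cast this

theorem fac_dvd (a m : ℕ) : m.factorial ∣ 2 ^ m * ∏ i ∈ Finset.range m, (a + 4 * i) := by
  obtain ⟨s, o, ho, h⟩ := Nat.exists_eq_two_pow_mul_odd (n := m.factorial) (Nat.factorial_ne_zero m)
  have hs : s ≤ m := by
    rcases Nat.eq_zero_or_pos m with rfl | hm
    · by_contra hs
      have : 2 ∣ Nat.factorial 0 := by rw [h]; exact Dvd.dvd.mul_right (dvd_pow_self 2 (by omega)) _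
      simp at this
    · have h1 := Nat.emultiplicity_two_factorial_lt hm.ne'
      have h2 : 2 ^ s ∣ m.factorial := ⟨o, h⟩
      have h3 := le_emultiplicity_of_pow_dvd h2
      exact_mod_cast (h3.trans_lt h1).le
  have ho2 : o ∣ ∏ i ∈ Finset.range m, (a + 4 * i) := by
    have hcop : Nat.Coprime 4 o := by
      have : Nat.Coprime 2 o := (Nat.coprime_two_left).mpr ho
      exact Nat.Coprime.pow_left 2 this
    obtain ⟨t, ht⟩ : ∃ t : ℕ, (4 * t : ZMod o) = a := by
      have : NeZero o := ⟨by rintro rfl; simp at ho⟩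
      refine ⟨((4 : ZMod o)⁻¹ * a).val, ?_⟩
      rw [ZMod.natCast_val, ZMod.cast_id, ← mul_assoc]
      have := ZMod.coe_mul_inv_eq_one 4 hcop
      push_cast at this
      rw [this, one_mul]
    rw [← ZMod.natCast_eq_zero_iff]
    push_cast
    rw [← ht]
    have e : ∏ i ∈ Finset.range m, ((4:ZMod o) * t + 4 * i) = 4 ^ m * ((t.ascFactorial m : ℕ) : ZMod o) := by
      rw [Nat.ascFactorial_eq_prod_range]
      push_cast
      rw [← Finset.card_range m, ← Finset.prod_const, Finset.card_range, ← Finset.prod_mul_distrib]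
      exact Finset.prod_congr rfl fun i _ => by ring
    rw [e]
    have : ((t.ascFactorial m : ℕ) : ZMod o) = 0 := by
      rw [ZMod.natCast_eq_zero_iff]
      refine dvd_trans ⟨2 ^ s, ?_⟩ (Nat.factorial_dvd_ascFactorial t m)
      rw [h]; ring
    rw [this, mul_zero]
  rw [h]
  exact mul_dvd_mul (pow_dvd_pow 2 hs) ho2

theorem cc_int (r k : ℕ) (hk : k ≤ r) : ∃ N : ℤ, 8 ^ r * cc r k = N := by
  obtain ⟨m, rfl⟩ := Nat.exists_eq_add_of_le hk
  obtain ⟨N1, h1⟩ := fac_dvd (4 * k + 3) m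
  obtain ⟨N2, h2⟩ := fac_dvd (4 * m + 5) k
  refine ⟨N1 * N2, ?_⟩
  have f1 : (0:ℝ) < k.factorial := by positivity
  have f2 : (0:ℝ) < m.factorial := by positivity
  have e1 : 8 ^ m * ca (k + m) = ca k * (m.factorial * N1) := by
    have : (4:ℝ) ^ m * ∏ i ∈ Finset.range m, (((k + i : ℕ) : ℝ) + 3 / 4) = ∏ i ∈ Finset.range m, ((4 * k + 3 + 4 * i : ℕ) : ℝ) := by
      rw [← Finset.card_range m, ← Finset.prod_const, Finset.card_range, ← Finset.prod_mul_distrib]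
      exact Finset.prod_congr rfl fun i _ => by push_cast; ring
    have h1' : (2:ℝ) ^ m * ∏ i ∈ Finset.range m, ((4 * k + 3 + 4 * i : ℕ) : ℝ) = m.factorial * N1 := by
      exact_mod_cast h1
    rw [← h1', ← this]
    unfold ca
    rw [Finset.prod_range_add, show (8:ℝ) = 2 * 4 by norm_num, mul_pow]
    ring
  have e2 : 8 ^ k * cb (k + m) = cb m * (k.factorial * N2) := by
    have : (4:ℝ) ^ k * ∏ i ∈ Finset.range k, (((m + i : ℕ) : ℝ) + 5 / 4) = ∏ i ∈ Finset.range k, ((4 * m + 5 + 4 * i : ℕ) : ℝ) := by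
      rw [← Finset.card_range k, ← Finset.prod_const, Finset.card_range, ← Finset.prod_mul_distrib]
      exact Finset.prod_congr rfl fun i _ => by push_cast; ring
    have h1' : (2:ℝ) ^ k * ∏ i ∈ Finset.range k, ((4 * m + 5 + 4 * i : ℕ) : ℝ) = k.factorial * N2 := by
      exact_mod_cast h2
    rw [← h1', ← this, add_comm k m]
    unfold cb
    rw [Finset.prod_range_add, show (8:ℝ) = 2 * 4 by norm_num, mul_pow]
    ring
  unfold cc
  rw [show k + m - k = m by omega]
  have p1 := ca_pos k; have p2 := cb_pos m
  rw [mul_div_assoc', div_eq_iff (by positivity), pow_add]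
  push_cast
  calc (8:ℝ) ^ k * 8 ^ m * (ca (k + m) * cb (k + m)) = (8 ^ m * ca (k + m)) * (8 ^ k * cb (k + m)) := by ring
    _ = _ := by rw [e1, e2]; ring


open GaussianInt in
theorem im_zero (g ζ : ℂ) (γ : GI) (hζ : ζ ^ 8 = 1) (hg : g = ζ * toComplex γ) (hs : 2 * g.im ^ 2 < 1) : g.im = 0 := by
  have h1 : Complex.normSq g = Complex.normSq (toComplex γ) := by
    have h2 : ‖ζ‖ = 1 := Complex.norm_eq_one_of_pow_eq_one hζ (by norm_num)
    rw [hg, map_mul, Complex.normSq_eq_norm_sq ζ, h2]; ring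
  have h3 : ∃ e : GI, toComplex e = ζ ^ 2 := by
    have h4 : (ζ ^ 2 - 1) * (ζ ^ 2 + 1) * (ζ ^ 2 - Complex.I) * (ζ ^ 2 + Complex.I) = 0 := by
      linear_combination hζ + (- ζ ^ 4 + 1) * Complex.I_sq
    rcases mul_eq_zero.mp h4 with h4 | h4
    · rcases mul_eq_zero.mp h4 with h4 | h4
      · rcases mul_eq_zero.mp h4 with h4 | h4
        · exact ⟨1, by rw [map_one]; linear_combination -h4⟩
        · exact ⟨-1, by rw [map_neg, map_one]; linear_combination -h4⟩
      · exact ⟨⟨0, 1⟩, by rw [toComplex_def']; push_cast; linear_combination -h4⟩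
    · exact ⟨⟨0, -1⟩, by rw [toComplex_def']; push_cast; linear_combination -h4⟩
  obtain ⟨e, he⟩ := h3
  have h5 : g ^ 2 = toComplex (e * γ ^ 2) := by
    rw [map_mul, map_pow, he, hg]; ring
  have h6 : (g ^ 2).re = ((e * γ ^ 2).re : ℤ) := by rw [h5]; simp; ring
  have h7 : Complex.normSq (toComplex γ) = ((γ.norm : ℤ) : ℝ) := by
    rw [Complex.normSq_apply, Zsqrtd.norm_def]; simp
  have h8 : 2 * g.im ^ 2 = ((γ.norm - (e * γ ^ 2).re : ℤ) : ℝ) := by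
    push_cast
    rw [← h6, ← h7, ← h1, Complex.normSq_apply, pow_two g, Complex.mul_re]; ring
  have h9 : (γ.norm - (e * γ ^ 2).re : ℤ) < 1 := by
    have := h8 ▸ hs
    exact_mod_cast this
  have h10 : 0 ≤ (γ.norm - (e * γ ^ 2).re : ℤ) := by
    have : 0 ≤ 2 * g.im ^ 2 := by positivity
    rw [h8] at this
    exact_mod_cast this
  have h11 : (γ.norm - (e * γ ^ 2).re : ℤ) = 0 := by omega
  rw [h11] at h8
  have : g.im ^ 2 = 0 := by push_cast at h8; linarith
  exact pow_eq_zero_iff (by norm_num) |>.mp this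

theorem gauss4 (X Y : ℤ) (h : X ^ 2 + 1 = 2 * Y ^ 4) :
    ∃ (σ s : ℤ) (β : GI), (σ = 1 ∨ σ = -1) ∧ s ^ 2 = 1 ∧ (⟨X, σ⟩ : GI) = ⟨1, 1⟩ * (s : GI) * β ^ 4 := by
  obtain ⟨u, β, hu, h1, -⟩ := gauss_lem X Y 4 (by norm_num) h
  have h2 : u.norm = 1 := (Zsqrtd.norm_eq_one_iff' (by norm_num) u).mpr hu
  rw [Zsqrtd.norm_def] at h2
  have h2 : u.re ^ 2 + u.im ^ 2 = 1 := by linarith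
  have hc : u.im = 0 ∧ u.re ^ 2 = 1 ∨ u.re = 0 ∧ u.im ^ 2 = 1 := by
    by_cases h0 : u.im = 0
    · left; refine ⟨h0, ?_⟩; rw [h0] at h2; linarith
    · right
      have : 1 ≤ u.im ^ 2 := by
        have : 0 < u.im ^ 2 := by positivity
        omega
      have : u.re ^ 2 = 0 := by nlinarith [sq_nonneg u.re]
      exact ⟨by simpa using this, by linarith⟩
  rcases hc with ⟨ha, hb⟩ | ⟨ha, hb⟩
  · refine ⟨1, u.re, β, Or.inl rfl, hb, ?_⟩
    rw [h1]; congr 2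
    ext
    · simp
    · simp [ha]
  · refine ⟨-1, -u.im, star β, Or.inr rfl, by linarith, ?_⟩
    have h3 := congrArg star h1
    have e1 : star (⟨X, 1⟩ : GI) = ⟨X, -1⟩ := by rfl
    rw [e1, star_mul', star_mul', star_pow] at h3
    rw [h3]; congr 1
    ext
    · simp [ha]
    · simp [ha]

open GaussianInt in
theorem key_int (X Y : ℤ) (hX : 0 < X) (hY : 0 < Y) (h : X ^ 2 + 1 = 2 * Y ^ 4) :
    ∃ σ : ℝ, |σ| = 1 ∧ ∀ r : ℕ, ∀ J : ℝ,
      J = √(13 * Y) * 1352 ^ r * ∑ k ∈ Finset.range (r + 1), cc r k * Real.sin ((1 / 4 + r - 2 * k) * tau + σ * Real.arctan (1 / X) / 4) →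
      2 * J ^ 2 < 1 → J = 0 := by
  obtain ⟨σ, s, β, hσ, hs, hβ⟩ := gauss4 X Y h
  have hσ2 : (σ : ℝ) ^ 2 = 1 := by rcases hσ with rfl | rfl <;> norm_num
  refine ⟨σ, by rcases hσ with rfl | rfl <;> norm_num, ?_⟩
  have hXr : (0 : ℝ) < X := by exact_mod_cast hX
  have hYr : (0 : ℝ) < Y := by exact_mod_cast hY
  have hr : (X : ℝ) ^ 2 + 1 = 2 * Y ^ 4 := by exact_mod_cast h
  set φ : ℝ := (tau + σ * Real.arctan (1 / X)) / 4 with hφ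
  -- exponentials of the angles
  have s2 : (√2 : ℝ) ^ 2 = 2 := Real.sq_sqrt (by norm_num)
  have s2p : (0 : ℝ) < √2 := by positivity
  have ct : Real.cos tau = 239 / (169 * √2) := by
    have h1 := cos_tau_sq
    have h2 := cos_tau_pos
    rw [← sq_eq_sq₀ h2.le (by positivity), h1, div_pow, mul_pow, s2]; norm_num
  have st : Real.sin tau = 1 / (169 * √2) := by
    have h1 : Real.tan tau = 1 / 239 := Real.tan_arctan _
    have h2 := cos_tau_pos
    rw [Real.tan_eq_sin_div_cos, div_eq_iff h2.ne', ct] at h1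
    rw [h1]; field_simp
  have cx : Real.cos (Real.arctan (1 / X)) = X / (√2 * Y ^ 2) := by
    have h2 := Real.cos_arctan_pos (1 / (X : ℝ))
    rw [← sq_eq_sq₀ h2.le (by positivity), Real.cos_sq_arctan, div_pow, div_pow, mul_pow, s2]
    field_simp
    linarith
  have sx : Real.sin (Real.arctan (1 / X)) = 1 / (√2 * Y ^ 2) := by
    have h1 : Real.tan (Real.arctan (1 / X)) = 1 / X := Real.tan_arctan _
    have h2 := Real.cos_arctan_pos (1 / (X : ℝ))
    rw [Real.tan_eq_sin_div_cos, div_eq_iff h2.ne', cx] at h1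
    rw [h1]; field_simp
  have sc : ((√2 : ℝ) : ℂ) ^ 2 = 2 := by exact_mod_cast s2
  have sc0 : ((√2 : ℝ) : ℂ) ≠ 0 := by exact_mod_cast s2p.ne'
  have hYc : (Y : ℂ) ≠ 0 := by exact_mod_cast hYr.ne'
  have Et : Complex.exp (tau * Complex.I) * (169 * (√2 : ℝ)) = 239 + Complex.I := by
    rw [Complex.exp_mul_I, ← Complex.ofReal_cos, ← Complex.ofReal_sin, ct, st]
    push_cast; field_simp
  have Emt : Complex.exp (-(tau * Complex.I)) * (169 * (√2 : ℝ)) = 239 - Complex.I := by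
    rw [← neg_mul, Complex.exp_mul_I, Complex.cos_neg, Complex.sin_neg, ← Complex.ofReal_cos, ← Complex.ofReal_sin, ct, st]
    push_cast; field_simp; ring
  have Ex : Complex.exp ((σ * Real.arctan (1 / X) : ℝ) * Complex.I) * ((√2 : ℝ) * Y ^ 2) = X + σ * Complex.I := by
    rw [Complex.exp_mul_I, ← Complex.ofReal_cos, ← Complex.ofReal_sin]
    have e1 : Real.cos (σ * Real.arctan (1 / X)) = X / (√2 * Y ^ 2) := by
      rcases hσ with rfl | rfl
      · simpa using cx
      · simpa using cx
    have e2 : Real.sin (σ * Real.arctan (1 / X)) = σ / (√2 * Y ^ 2) := by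
      rcases hσ with rfl | rfl
      · simpa using sx
      · simp at sx ⊢; rw [sx]; field_simp
    rw [e1, e2]
    push_cast; field_simp
  -- the element Γ
  set Γ : ℂ := (√(13 * Y) : ℝ) * Complex.exp (φ * Complex.I) with hΓ
  have hΓ4 : Γ ^ 4 * 2 = (239 + Complex.I) * (X + σ * Complex.I) := by
    have e1 : Complex.exp (φ * Complex.I) ^ 4 = Complex.exp (tau * Complex.I) * Complex.exp ((σ * Real.arctan (1 / X) : ℝ) * Complex.I) := by
      rw [← Complex.exp_nat_mul, ← Complex.exp_add]; congr 1; rw [hφ]; push_cast; ring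
    have e2 : ((√(13 * Y) : ℝ) : ℂ) ^ 2 = 13 * Y := by
      have : (√(13 * Y) : ℝ) ^ 2 = 13 * Y := Real.sq_sqrt (by positivity)
      exact_mod_cast this
    rw [← Et, ← Ex, hΓ, mul_pow, e1, show 4 = 2 * 2 by rfl, pow_mul, e2]
    linear_combination -(169 * Y ^ 2 * Complex.exp (tau * Complex.I) * Complex.exp ((σ * Real.arctan (1 / X) : ℝ) * Complex.I)) * sc
  set G : GI := β * ⟨3, -2⟩ with hG
  have hβc : (X : ℂ) + σ * Complex.I = (1 + Complex.I) * s * toComplex β ^ 4 := by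
    have := congrArg toComplex hβ
    rw [map_mul, map_mul, map_pow, toComplex_def', toComplex_def'] at this
    rw [this]; simp
  have hGc : toComplex G = toComplex β * (3 - 2 * Complex.I) := by
    rw [hG, map_mul, toComplex_def' 3 (-2)]; push_cast; ring
  have hΓG : Γ ^ 4 = - s * toComplex G ^ 4 := by
    have I2 := Complex.I_sq
    have e3 : (3 - 2 * Complex.I) ^ 4 = -119 - 120 * Complex.I := by
      linear_combination (16 * Complex.I ^ 2 - 96 * Complex.I + 200) * I2
    have : Γ ^ 4 * 2 = (- s * toComplex G ^ 4) * 2 := by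
      rw [hΓ4, hβc, hGc, mul_pow, e3]
      linear_combination (s * toComplex β ^ 4) * I2
    exact mul_right_cancel₀ two_ne_zero this
  have hΓ0 : Γ ≠ 0 := by
    rw [hΓ]
    refine mul_ne_zero ?_ (Complex.exp_ne_zero _)
    have : 0 < √(13 * (Y : ℝ)) := by positivity
    exact_mod_cast this.ne'
  have hG0 : toComplex G ≠ 0 := by
    intro h0
    rw [h0] at hΓG
    exact hΓ0 (by simpa using hΓG)
  set ζ : ℂ := Γ / toComplex G with hζ
  have hsc : (s : ℂ) ^ 2 = 1 := by exact_mod_cast hs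
  have hζ8 : ζ ^ 8 = 1 := by
    rw [hζ, div_pow, div_eq_one_iff_eq (pow_ne_zero _ hG0), show 8 = 4 * 2 by rfl, pow_mul, hΓG, pow_mul]
    linear_combination (toComplex G ^ 4) ^ 2 * hsc
  have hΓζ : Γ = ζ * toComplex G := by rw [hζ]; field_simp
  intro r J hJ hJ2
  choose! N hN using cc_int r
  set ω : ℂ := (1 + Complex.I) / (√2 : ℝ) with hω
  have hω2 : ω ^ 2 = Complex.I := by
    rw [hω, div_pow, sc]; linear_combination Complex.I_sq / 2
  have hω8 : ω ^ 8 = 1 := by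
    rw [show 8 = 2 * 4 by rfl, pow_mul, hω2, Complex.I_pow_four]
  have hP : 169 * Complex.exp (tau * Complex.I) = ω * toComplex ⟨120, -119⟩ := by
    rw [toComplex_def', hω]; push_cast
    field_simp
    linear_combination Et + 119 * Complex.I_sq
  have hQ : 169 * Complex.exp (-(tau * Complex.I)) = ω * toComplex ⟨119, -120⟩ := by
    rw [toComplex_def', hω]; push_cast
    field_simp
    linear_combination Emt + 120 * Complex.I_sq
  have hterm : ∀ k ∈ Finset.range (r + 1), (1352 : ℂ) ^ r * ((cc r k : ℝ) * Complex.exp (((r - 2 * k : ℝ) * tau : ℝ) * Complex.I))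
      = ω ^ r * toComplex ((N k : GI) * (⟨120, -119⟩ ^ (r - k) * ⟨119, -120⟩ ^ k)) := by
    intro k hk
    have hk' : k ≤ r := by simpa [Nat.lt_succ_iff] using hk
    have h1 : (8 : ℂ) ^ r * (cc r k : ℝ) = N k := by exact_mod_cast hN k hk'
    obtain ⟨m, hm⟩ := Nat.exists_eq_add_of_le hk'
    have h2 : Complex.exp (((r - 2 * k : ℝ) * tau : ℝ) * Complex.I) = Complex.exp (tau * Complex.I) ^ m * Complex.exp (-(tau * Complex.I)) ^ k := by
      rw [← Complex.exp_nat_mul, ← Complex.exp_nat_mul, ← Complex.exp_add]; congr 1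
      rw [hm]; push_cast; ring
    have h3 : (169 : ℂ) ^ r * Complex.exp (((r - 2 * k : ℝ) * tau : ℝ) * Complex.I) = ω ^ r * (toComplex ⟨120, -119⟩ ^ m * toComplex ⟨119, -120⟩ ^ k) := by
      rw [h2]
      calc _ = (169 * Complex.exp (tau * Complex.I)) ^ m * (169 * Complex.exp (-(tau * Complex.I))) ^ k := by
            rw [mul_pow, mul_pow, hm, pow_add]; ring
        _ = _ := by rw [hP, hQ, mul_pow, mul_pow, hm, pow_add]; ring
    rw [map_mul, map_mul, map_pow, map_pow, map_intCast, ← h1, show r - k = m by omega]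
    rw [show (1352 : ℂ) = 8 * 169 by norm_num, mul_pow]
    linear_combination ((8 : ℂ) ^ r * (cc r k : ℝ)) * h3
  set g : ℂ := Γ * (1352 ^ r * ∑ k ∈ Finset.range (r + 1), (cc r k : ℝ) * Complex.exp (((r - 2 * k : ℝ) * tau : ℝ) * Complex.I)) with hg
  have hg1 : g = (ζ * ω ^ r) * toComplex (G * ∑ k ∈ Finset.range (r + 1), (N k : GI) * (⟨120, -119⟩ ^ (r - k) * ⟨119, -120⟩ ^ k)) := by
    rw [hg, Finset.mul_sum, Finset.sum_congr rfl hterm, ← Finset.mul_sum, ← map_sum, map_mul, hΓζ]; ring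
  have hgJ : g.im = J := by
    have : g = ((√(13 * Y) * 1352 ^ r : ℝ) : ℂ) * ∑ k ∈ Finset.range (r + 1), (cc r k : ℝ) * Complex.exp (((1 / 4 + r - 2 * k) * tau + σ * Real.arctan (1 / X) / 4 : ℝ) * Complex.I) := by
      rw [hg, hΓ]
      rw [Finset.mul_sum, Finset.mul_sum, Finset.mul_sum]
      refine Finset.sum_congr rfl fun k _ => ?_
      have : Complex.exp (((1 / 4 + r - 2 * k) * tau + σ * Real.arctan (1 / X) / 4 : ℝ) * Complex.I) = Complex.exp (φ * Complex.I) * Complex.exp (((r - 2 * k : ℝ) * tau : ℝ) * Complex.I) := by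
        rw [← Complex.exp_add]; congr 1; rw [hφ]; push_cast; ring
      rw [this]; push_cast; ring
    rw [this, Complex.im_ofReal_mul, Complex.im_sum, hJ]
    congr 1
    refine Finset.sum_congr rfl fun k _ => ?_
    rw [Complex.im_ofReal_mul, Complex.exp_ofReal_mul_I_im]
  rw [← hgJ]
  refine im_zero g (ζ * ω ^ r) _ ?_ hg1 (by rw [hgJ]; exact hJ2)
  rw [mul_pow, hζ8, ← pow_mul, mul_comm r 8, pow_mul, hω8]; simp


theorem sin_diff (a δ : ℝ) : |Real.sin (a + δ) - Real.sin a| ≤ |δ| := by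
  have h := Real.sin_sub_sin (a + δ) a
  rw [h]
  have h1 : |Real.sin ((a + δ - a) / 2)| ≤ |δ| / 2 := by
    have : (a + δ - a) / 2 = δ / 2 := by ring
    rw [this]
    calc |Real.sin (δ / 2)| ≤ |δ / 2| := Real.abs_sin_le_abs
      _ = _ := by rw [abs_div]; norm_num
  have h2 := Real.abs_cos_le_one ((a + δ + a) / 2)
  rw [abs_mul, abs_mul]
  have := abs_nonneg (Real.sin ((a + δ - a) / 2))
  rw [abs_two]
  nlinarith [abs_nonneg (Real.cos ((a + δ + a) / 2))]

theorem large_case (X Y : ℤ) (hX : 0 < X) (hY : 15000000000 ≤ Y) (h : X ^ 2 + 1 = 2 * Y ^ 4) : False := by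
  obtain ⟨σ, hσ, H⟩ := key_int X Y hX (by linarith) h
  have hYr : (15000000000 : ℝ) ≤ Y := by exact_mod_cast hY
  have hXr : (0 : ℝ) < X := by exact_mod_cast hX
  have hXY : Y ^ 2 ≤ X := by
    by_contra hc
    push Not at hc
    have h1 : X ^ 2 + 1 ≤ Y ^ 4 := by nlinarith
    have : 0 < Y ^ 4 := by positivity
    linarith
  have hXYr : (Y : ℝ) ^ 2 ≤ X := by exact_mod_cast hXY
  set δ : ℝ := σ * Real.arctan (1 / X) / 4 with hδ
  have hδb : |δ| ≤ 1 / (4 * Y ^ 2) := by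
    have h1 := arctan_le_self' (1 / X) (by positivity)
    have h2 : 0 ≤ Real.arctan (1 / X) := Real.arctan_nonneg.mpr (by positivity)
    rw [hδ, abs_div, abs_mul, hσ, abs_of_nonneg h2, one_mul]
    have h3 : 1 / (X : ℝ) ≤ 1 / Y ^ 2 := one_div_le_one_div_of_le (by positivity) hXYr
    rw [show 1 / (4 * (Y : ℝ) ^ 2) = (1 / Y ^ 2) / 4 by field_simp]
    norm_num
    norm_num at h1 h3
    linarith
  -- the main comparison of sums
  have hdiff : ∀ r : ℕ, |∑ k ∈ Finset.range (r + 1), cc r k * Real.sin ((1 / 4 + r - 2 * k) * tau + δ) - Kf r tau| ≤ 4 ^ r * (1 / (4 * Y ^ 2)) := by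
    intro r
    rw [Kf, ← Finset.sum_sub_distrib]
    calc _ ≤ ∑ k ∈ Finset.range (r + 1), |cc r k * Real.sin ((1 / 4 + r - 2 * k) * tau + δ) - cc r k * Real.sin ((1 / 4 + r - 2 * k) * tau)| := Finset.abs_sum_le_sum_abs _ _
      _ ≤ ∑ k ∈ Finset.range (r + 1), cc r k * (1 / (4 * Y ^ 2)) := by
        refine Finset.sum_le_sum fun k _ => ?_
        rw [← mul_sub, abs_mul, abs_of_pos (cc_pos r k)]
        exact mul_le_mul_of_nonneg_left ((sin_diff _ _).trans hδb) (cc_pos r k).le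
      _ ≤ _ := by
        rw [← Finset.sum_mul]
        exact mul_le_mul_of_nonneg_right (cc_sum r) (by positivity)
  -- choice of r
  set q : ℝ := √(13 * Y) with hq
  have hq2 : q ^ 2 = 13 * Y := Real.sq_sqrt (by positivity)
  have hq0 : 0 < q := by positivity
  have hqb : 441000 ≤ q := by
    apply Real.le_sqrt_of_sq_le; nlinarith
  have hex : ∃ r : ℕ, q / 239 ≤ (57121 / 1352 : ℝ) ^ r := by
    obtain ⟨r, hr⟩ := pow_unbounded_of_one_lt (q / 239) (show (1 : ℝ) < 57121 / 1352 by norm_num)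
    exact ⟨r, hr.le⟩
  classical
  obtain ⟨r, hr1, hr2⟩ : ∃ r : ℕ, q / 239 ≤ (57121 / 1352 : ℝ) ^ r ∧ ∀ m < r, (57121 / 1352 : ℝ) ^ m < q / 239 :=
    ⟨Nat.find hex, Nat.find_spec hex, fun m hm => not_le.mp (Nat.find_min hex hm)⟩
  have hr3 : 3 ≤ r := by
    by_contra hc
    have : r ≤ 2 := by omega
    have h1 : (57121 / 1352 : ℝ) ^ r ≤ (57121 / 1352 : ℝ) ^ 2 := pow_le_pow_right₀ (by norm_num) this
    norm_num at h1 hr1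
    linarith
  obtain ⟨m, rfl⟩ : ∃ m, r = m + 1 := ⟨r - 1, by omega⟩
  have hr4 := hr2 m (by omega)
  set E : ℝ := 57121 / 1352 with hE
  have hEup : E ^ (m + 1) < q * (57121 / 323128) := by
    rw [pow_succ, hE] at *
    linarith
  have hEpos : 0 < E ^ (m + 1) := by rw [hE]; positivity
  obtain ⟨K1, K2⟩ := Kf_tau (m + 1)
  have hd := hdiff (m + 1)
  have hH := H (m + 1) _ rfl
  set S : ℝ := ∑ k ∈ Finset.range (m + 1 + 1), cc (m + 1) k * Real.sin ((1 / 4 + (m + 1 : ℕ) - 2 * k) * tau + δ) with hS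
  have hY0 : (0 : ℝ) < Y := by linarith
  have h5408 : (5408 : ℝ) ^ (m + 1) ≤ E ^ (m + 1) * E ^ (m + 1) * E ^ (m + 1) := by
    rw [← mul_pow, ← mul_pow]
    exact pow_le_pow_left₀ (by norm_num) (by rw [hE]; norm_num) _
  -- error term
  have herr : q * 1352 ^ (m + 1) * (4 ^ (m + 1) * (1 / (4 * Y ^ 2))) ≤ 1 / 4 := by
    have e1 : (1352 : ℝ) ^ (m + 1) * 4 ^ (m + 1) = 5408 ^ (m + 1) := by rw [← mul_pow]; norm_num
    have e2 : q * 1352 ^ (m + 1) * (4 ^ (m + 1) * (1 / (4 * (Y : ℝ) ^ 2))) = q * 5408 ^ (m + 1) / (4 * Y ^ 2) := by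
      rw [← e1]; ring
    rw [e2, div_le_iff₀ (by positivity)]
    have e3 : E ^ (m + 1) * E ^ (m + 1) * E ^ (m + 1) ≤ (q * (57121 / 323128)) * (q * (57121 / 323128)) * (q * (57121 / 323128)) := by
      gcongr
    calc q * 5408 ^ (m + 1) ≤ q * ((q * (57121 / 323128)) * (q * (57121 / 323128)) * (q * (57121 / 323128))) := by
          gcongr; exact h5408.trans e3
      _ = (q ^ 2) ^ 2 * (57121 / 323128) ^ 3 := by ring
      _ = Y ^ 2 * (169 * (57121 / 323128) ^ 3) := by rw [hq2]; ring
      _ ≤ Y ^ 2 * 1 := by gcongr; norm_num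
      _ = _ := by ring
  have hKup : q * 1352 ^ (m + 1) * |Kf (m + 1) tau| ≤ 1 / 4 := by
    have e1 : (1352 : ℝ) ^ (m + 1) * (1 / 57121) ^ (m + 1) * E ^ (m + 1) = 1 := by
      rw [← mul_pow, ← mul_pow, hE]; norm_num
    have e2 : q ≤ 239 * E ^ (m + 1) := by linarith
    calc q * 1352 ^ (m + 1) * |Kf (m + 1) tau| ≤ (239 * E ^ (m + 1)) * 1352 ^ (m + 1) * (1 / 956 * (1 / 57121) ^ (m + 1)) := by gcongr
      _ = (1352 : ℝ) ^ (m + 1) * (1 / 57121) ^ (m + 1) * E ^ (m + 1) * (1 / 4) := by ring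
      _ = 1 / 4 := by rw [e1]; norm_num
  have hJ0 : q * 1352 ^ (m + 1) * S = 0 := by
    apply hH
    have hb : |q * 1352 ^ (m + 1) * S| ≤ 1 / 2 := by
      have : 0 < q * 1352 ^ (m + 1) := by positivity
      rw [abs_mul, abs_of_pos this]
      have h1 : |S| ≤ |S - Kf (m + 1) tau| + |Kf (m + 1) tau| := by
        have := abs_add_le (S - Kf (m + 1) tau) (Kf (m + 1) tau)
        rwa [sub_add_cancel] at this
      calc q * 1352 ^ (m + 1) * |S| ≤ q * 1352 ^ (m + 1) * (4 ^ (m + 1) * (1 / (4 * Y ^ 2)) + |Kf (m + 1) tau|) := by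
            gcongr; linarith
        _ ≤ 1 / 4 + 1 / 4 := by rw [mul_add]; linarith
        _ = 1 / 2 := by norm_num
    have := sq_le_sq' (by linarith [neg_abs_le (q * 1352 ^ (m + 1) * S)]) ((le_abs_self _).trans hb)
    linarith
  have hS0 : S = 0 := by
    rcases mul_eq_zero.mp hJ0 with h1 | h1
    · have : 0 < q * 1352 ^ (m + 1) := by positivity
      linarith
    · exact h1
  rw [hS0, zero_sub, abs_neg] at hd
  have hfin := K1.trans hd
  have f1 : (4 : ℝ) ^ (m + 1) * 142805 ^ (m + 1) = 571220 ^ (m + 1) := by rw [← mul_pow]; norm_num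
  have f2 : (1 / 142805 : ℝ) ^ (m + 1) * 142805 ^ (m + 1) = 1 := by rw [← mul_pow]; norm_num
  have f3 : 476 / 114244 * (Y : ℝ) ^ 2 ≤ 571220 ^ (m + 1) := by
    have e1 : (119 / 114244 * (1 / 142805) ^ (m + 1)) * (142805 ^ (m + 1) * (4 * (Y : ℝ) ^ 2)) ≤ (4 ^ (m + 1) * (1 / (4 * (Y : ℝ) ^ 2))) * (142805 ^ (m + 1) * (4 * (Y : ℝ) ^ 2)) := by
      gcongr
    have e2 : (119 / 114244 * (1 / 142805) ^ (m + 1)) * (142805 ^ (m + 1) * (4 * (Y : ℝ) ^ 2)) = 476 / 114244 * (Y : ℝ) ^ 2 := by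
      linear_combination (476 / 114244 * (Y : ℝ) ^ 2) * f2
    have e3 : (4 ^ (m + 1) * (1 / (4 * (Y : ℝ) ^ 2))) * (142805 ^ (m + 1) * (4 * (Y : ℝ) ^ 2)) = 571220 ^ (m + 1) := by
      rw [← f1]; field_simp
    rwa [e2, e3] at e1
  have f4 : (E ^ (m + 1)) ^ 4 ≤ (q * (57121 / 323128)) ^ 4 := by gcongr
  have f5 : (q * (57121 / 323128)) ^ 4 = Y ^ 2 * (169 * (57121 / 323128) ^ 4) := by
    rw [mul_pow, show q ^ 4 = (q ^ 2) ^ 2 by ring, hq2]; ring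
  have f6 : (E ^ (m + 1)) ^ 4 = (E ^ 4 / 571220) ^ (m + 1) * 571220 ^ (m + 1) := by
    rw [← mul_pow, ← pow_mul, mul_comm (m + 1) 4, pow_mul]; congr 1; ring
  have f7 : (170 : ℝ) ≤ (E ^ 4 / 571220) ^ (m + 1) := by
    calc (170 : ℝ) ≤ (E ^ 4 / 571220) ^ 3 := by rw [hE]; norm_num
      _ ≤ _ := pow_le_pow_right₀ (by rw [hE]; norm_num) hr3
  have f8 : (170 : ℝ) * 571220 ^ (m + 1) ≤ (E ^ (m + 1)) ^ 4 := by
    rw [f6]; gcongr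
  have f9 : 0 < (Y : ℝ) ^ 2 := by positivity
  norm_num at f5
  linarith


def pseq : ℕ → ℕ × ℕ
  | 0 => (1, 1)
  | m + 1 => (3 * (pseq m).1 + 4 * (pseq m).2, 2 * (pseq m).1 + 3 * (pseq m).2)

theorem pell_seq (W : ℕ) : ∀ X : ℕ, X ^ 2 + 1 = 2 * W ^ 2 → ∃ m, pseq m = (X, W) := by
  induction W using Nat.strong_induction_on with
  | _ W ih =>
    intro X h
    rcases Nat.lt_or_ge W 2 with hW | hW
    · interval_cases W
      · omega
      · have : X = 1 := by nlinarith
        exact ⟨0, by rw [this]; rfl⟩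
    · have h1 : W < X := by nlinarith
      have h2 : 2 * X < 3 * W := by nlinarith
      have h3 : 4 * W ≤ 3 * X := by nlinarith
      obtain ⟨a, ha⟩ := Nat.exists_eq_add_of_le h3
      obtain ⟨b, hb⟩ := Nat.exists_eq_add_of_le h2.le
      have h4 : a ^ 2 + 1 = 2 * b ^ 2 := by
        zify at *
        have ha' : (a : ℤ) = 3 * X - 4 * W := by linarith
        have hb' : (b : ℤ) = 3 * W - 2 * X := by linarith
        rw [ha', hb']; linarith
      obtain ⟨m, hm⟩ := ih b (by omega) a h4
      refine ⟨m + 1, ?_⟩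
      rw [pseq, hm]
      ext <;> simp only [] <;> omega

theorem pseq_ge (m : ℕ) : 5 ^ m ≤ (pseq m).2 ∧ (pseq m).2 ≤ (pseq m).1 := by
  induction m with
  | zero => simp [pseq]
  | succ m ih => rw [pseq, pow_succ]; simp only []; omega

theorem pseq_sq : ∀ m < 30, m = 0 ∨ m = 3 ∨ ∃ p ∈ [3, 7, 13, 19, 23, 31], ∀ y < p, y * y % p ≠ (pseq m).2 % p := by
  decide +kernel

theorem ljunggren (X Y : ℤ) (hY : 0 < Y) (h : X ^ 2 + 1 = 2 * Y ^ 4) : Y = 1 ∨ Y = 13 := by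
  have hX : X ≠ 0 := by
    rintro rfl
    omega
  have h' : |X| ^ 2 + 1 = 2 * Y ^ 4 := by rw [sq_abs]; exact h
  have hlt : Y < 15000000000 := by
    by_contra hc
    exact large_case |X| Y (abs_pos.mpr hX) (by linarith) h'
  lift Y to ℕ using hY.le
  obtain ⟨A, hA⟩ : ∃ A : ℕ, |X| = A := ⟨X.natAbs, by simp⟩
  rw [hA] at h'
  have h2 : A ^ 2 + 1 = 2 * (Y ^ 2) ^ 2 := by
    rw [← pow_mul]; exact_mod_cast h'
  obtain ⟨m, hm⟩ := pell_seq (Y ^ 2) A h2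
  have hg := (pseq_ge m).1
  have hW : (pseq m).2 = Y ^ 2 := by rw [hm]
  have hYlt : Y < 15000000000 := by exact_mod_cast hlt
  have hm30 : m < 30 := by
    by_contra hc
    have h5 : 5 ^ 30 ≤ 5 ^ m := Nat.pow_le_pow_right (by norm_num) (by omega)
    rw [hW] at hg
    have : Y ^ 2 ≤ 15000000000 ^ 2 := Nat.pow_le_pow_left hYlt.le 2
    norm_num at *
    omega
  rcases pseq_sq m hm30 with rfl | rfl | ⟨p, hp, hq⟩
  · left
    have : Y ^ 2 = 1 := by rw [← hW]; rfl
    have : Y = 1 := by nlinarith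
    exact_mod_cast this
  · right
    have : Y ^ 2 = 169 := by rw [← hW]; rfl
    have : Y = 13 := by nlinarith
    exact_mod_cast this
  · exfalso
    have hp0 : 0 < p := by
      simp at hp; omega
    refine hq (Y % p) (Nat.mod_lt _ hp0) ?_
    rw [hW, pow_two, ← Nat.mul_mod]


theorem case2 (X y : ℤ) (n : ℕ) (hn : 3 ≤ n) (h : X ^ 2 + 1 = 2 * y ^ n) :
    (X ^ 2 = 1 ∧ (y = 1 ∨ y = -1 ∧ Even n)) ∨ (X ^ 2 = 239 ^ 2 ∧ (y = 13 ∨ y = -13) ∧ n = 4) := by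
  have core : y ^ n = 1 ∨ ((y = 13 ∨ y = -13) ∧ n = 4) := by
    obtain ⟨a, q, ⟨k, rfl⟩, hnq⟩ := Nat.exists_eq_two_pow_mul_odd (show n ≠ 0 by omega)
    rcases Nat.eq_zero_or_pos k with rfl | hk
    · have ha : 2 ≤ a := by
        by_contra hc
        have : a < 2 := by omega
        interval_cases a <;> omega
      obtain ⟨b, rfl⟩ := Nat.exists_eq_add_of_le ha
      have hn4 : n = 2 ^ b * 4 := by rw [hnq, pow_add]; ring
      have hy0 : y ≠ 0 := by
        rintro rfl
        rw [zero_pow (by omega)] at h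
        nlinarith [sq_nonneg X]
      have hpos : 0 < |y ^ (2 ^ b)| := abs_pos.mpr (pow_ne_zero _ hy0)
      have h4 : |y ^ (2 ^ b)| ^ 4 = y ^ n := by
        rw [show |y ^ (2 ^ b)| ^ 4 = (|y ^ (2 ^ b)| ^ 2) ^ 2 by ring, sq_abs, ← pow_mul, ← pow_mul, hn4]
      rw [← h4] at h
      rcases ljunggren X _ hpos h with h1 | h1
      · left; rw [← h4, h1]; norm_num
      · right
        rcases Nat.eq_zero_or_pos b with rfl | hb
        · refine ⟨?_, by omega⟩
          simp only [pow_zero, pow_one] at h1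
          rcases abs_choice y with h2 | h2 <;> omega
        · exfalso
          obtain ⟨c, rfl⟩ : ∃ c, b = c + 1 := ⟨b - 1, by omega⟩
          rw [pow_succ 2 c, pow_mul, abs_of_nonneg (sq_nonneg _)] at h1
          generalize y ^ 2 ^ c = z at h1
          have h5 : z ≤ 3 := by nlinarith
          have h6 : -3 ≤ z := by nlinarith
          interval_cases z <;> omega
    · left
      rw [hnq, pow_mul] at h
      have := stormer X _ k hk h
      rw [hnq, pow_mul, this, one_pow]
  rcases core with h1 | ⟨h1, rfl⟩
  · left
    rw [h1] at h
    refine ⟨by linarith, ?_⟩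
    rcases pow_eq_one_iff_cases.mp h1 with h2 | h2
    · omega
    · exact h2
  · right
    refine ⟨?_, h1, rfl⟩
    rcases h1 with rfl | rfl <;> linarith

theorem prime_sq_dvd (p : ℕ) (hp : p.Prime) (y : ℤ) (n j : ℕ) (hj : j ≤ n) (h : (p : ℤ) ∣ y ^ n) : (p : ℤ) ^ j ∣ y ^ n :=
  (pow_dvd_pow_of_dvd ((Nat.prime_iff_prime_int.mp hp).dvd_of_dvd_pow h) j).trans (pow_dvd_pow y hj)

set_option maxHeartbeats 1000000 in
theorem perfect_powers_sums_consecutive_squares (d : ℕ) (hd : 2 ≤ d) (hd' : d ≤ 10)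
    (x y : ℤ) (n : ℕ) (hn : 3 ≤ n)
    (h : ∑ i ∈ Finset.range d, (x + (i : ℤ) + 1) ^ 2 = y ^ n) :
    d = 2 ∧
      ((x = -1 ∧ (y = 1 ∨ y = -1) ∧ Even n) ∨
        (x = -2 ∧ (y = 1 ∨ y = -1) ∧ Even n) ∨
        (x = -1 ∧ y = 1 ∧ Odd n) ∨
        (x = -2 ∧ y = 1 ∧ Odd n) ∨
        (x = 118 ∧ (y = 13 ∨ y = -13) ∧ n = 4) ∨
        (x = -121 ∧ (y = 13 ∨ y = -13) ∧ n = 4)) := by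
  have P2 := prime_sq_dvd 2 Nat.prime_two y n 3 hn
  have P3 := prime_sq_dvd 3 Nat.prime_three y n 2 (by omega)
  have P5 := prime_sq_dvd 5 Nat.prime_five y n 2 (by omega)
  have P7 := prime_sq_dvd 7 (by norm_num) y n 2 (by omega)
  rw [← h] at P2 P3 P5 P7
  norm_num at P2 P3 P5 P7
  interval_cases d <;> simp [Finset.sum_range_succ] at h P2 P3 P5 P7
  · refine ⟨rfl, ?_⟩
    have h2 : (2 * x + 3) ^ 2 + 1 = 2 * y ^ n := by rw [← h]; ring
    rcases case2 _ y n hn h2 with ⟨h3, h4⟩ | ⟨h3, h4⟩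
    · have hx : x = -1 ∨ x = -2 := by
        rcases sq_eq_sq_iff_eq_or_eq_neg.mp (h3.trans (one_pow 2).symm) with h5 | h5 <;> omega
      clear h h2 P2 P3 P5 P7
      rcases h4 with h4 | ⟨h4, h6⟩
      · rcases Nat.even_or_odd n with hp | hp <;> rcases hx with hx | hx <;> simp [hx, h4, hp]
      · rcases hx with hx | hx <;> simp [hx, h4, h6]
    · have hx : x = 118 ∨ x = -121 := by
        rcases sq_eq_sq_iff_eq_or_eq_neg.mp h3 with h5 | h5 <;> omega
      clear h h2 P2 P3 P5 P7
      obtain ⟨h4, h6⟩ := h4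
      rcases hx with hx | hx <;> rcases h4 with h4 | h4 <;> simp [hx, h4, h6]
  · exfalso
    clear P2 P3 P5 P7
    have h2 : 3 * (x + 2) ^ 2 + 2 = y ^ n := by rw [← h]; ring
    rcases Nat.even_or_odd' n with ⟨k, rfl | rfl⟩
    · rw [mul_comm 2 k, pow_mul] at h2
      have := sq_mod3 (y ^ k)
      omega
    · exact case3 _ y k (by omega) h2
  · exfalso
    clear h P3 P5 P7
    have e : (x + 1) ^ 2 + (x + 1 + 1) ^ 2 + (x + 2 + 1) ^ 2 + (x + 3 + 1) ^ 2 = 4 * (x * (x + 5)) + 30 := by ring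
    rw [e] at P2
    omega
  · exfalso
    clear h P2 P3 P7
    have e : (x + 1) ^ 2 + (x + 1 + 1) ^ 2 + (x + 2 + 1) ^ 2 + (x + 3 + 1) ^ 2 + (x + 4 + 1) ^ 2 = 5 * ((x + 3) ^ 2 + 2) := by ring
    rw [e] at P5
    have := sq_mod5 (x + 3)
    omega
  · exfalso
    clear P2 P3 P5 P7
    have h2 : 3 * (2 * x + 7) ^ 2 + 35 = 2 * y ^ n := by rw [← h]; ring
    rcases Nat.even_or_odd' n with ⟨k, rfl | rfl⟩
    · rw [mul_comm 2 k, pow_mul] at h2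
      have e : 6 * (x * (x + 1)) + 36 * x + 91 = (y ^ k) ^ 2 := by linarith
      have h5 := Int.even_mul_succ_self x
      have h6 := Int.emod_two_eq_zero_or_one (y ^ k)
      obtain ⟨c, hc⟩ := h5
      rw [hc] at e
      rcases Int.even_or_odd' (y ^ k) with ⟨t, ht | ht⟩
      · rw [ht] at e; ring_nf at e; omega
      · rw [ht] at e; ring_nf at e; omega
    · exact case6 _ y k (by omega) h2
  · exfalso
    clear h P2 P3 P5
    have e : (x + 1) ^ 2 + (x + 1 + 1) ^ 2 + (x + 2 + 1) ^ 2 + (x + 3 + 1) ^ 2 + (x + 4 + 1) ^ 2 + (x + 5 + 1) ^ 2 + (x + 6 + 1) ^ 2 = 7 * ((x + 4) ^ 2 + 4) := by ring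
    rw [e] at P7
    have := sq_mod7 (x + 4)
    omega
  · exfalso
    clear h P3 P5 P7
    have e : (x + 1) ^ 2 + (x + 1 + 1) ^ 2 + (x + 2 + 1) ^ 2 + (x + 3 + 1) ^ 2 + (x + 4 + 1) ^ 2 + (x + 5 + 1) ^ 2 + (x + 6 + 1) ^ 2 + (x + 7 + 1) ^ 2 = 8 * (x * (x + 9)) + 204 := by ring
    rw [e] at P2
    omega
  · exfalso
    clear h P2 P5 P7
    have e : (x + 1) ^ 2 + (x + 1 + 1) ^ 2 + (x + 2 + 1) ^ 2 + (x + 3 + 1) ^ 2 + (x + 4 + 1) ^ 2 + (x + 5 + 1) ^ 2 + (x + 6 + 1) ^ 2 + (x + 7 + 1) ^ 2 + (x + 8 + 1) ^ 2 = 9 * (x + 5) ^ 2 + 60 := by ring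
    rw [e] at P3
    omega
  · exfalso
    clear h P2 P3 P7
    have e : (x + 1) ^ 2 + (x + 1 + 1) ^ 2 + (x + 2 + 1) ^ 2 + (x + 3 + 1) ^ 2 + (x + 4 + 1) ^ 2 + (x + 5 + 1) ^ 2 + (x + 6 + 1) ^ 2 + (x + 7 + 1) ^ 2 + (x + 8 + 1) ^ 2 + (x + 9 + 1) ^ 2 = 5 * (2 * (x + 3) ^ 2 + 10 * x + 59) := by ring
    rw [e] at P5
    have := sq_mod5 (x + 3)
    omega
end
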